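/- Let n ≥ 4. There exist constants ε ∈ (0,1) and C > 0, depending only on n (and ε), such that: for every R > 0 and every smooth solution (u, p) of the steady Navier-Stokes equations on ℝⁿ \ B_R satisfying |u(x)| ≤ ε/|x| for all |x| ≥ R, one has |u(x)| ≤ C R^{n−3} / |x|^{n−2} for all |x| ≥ R. In particular C is independent of R and of the solution u. -/

import Mathlib

namespace SteadyNS

open MeasureTheory Filter Topology Metric
open scoped ContDiff

/-- Euclidean space of dimension `n`. -/
abbrev Euc (n : ℕ) := EuclideanSpace ℝ (Fin n)

variable {n : ℕ}

/-- The `i`-th partial derivative. -/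
noncomputable def pd (i : Fin n) (f : Euc n → ℝ) : Euc n → ℝ :=
  fun y => fderiv ℝ f y (EuclideanSpace.single i 1)

/-- The Laplacian, as the sum of the second partial derivatives. -/
noncomputable def lap (f : Euc n → ℝ) : Euc n → ℝ := fun y => ∑ i, pd i (pd i f) y

/-- The divergence of a family of components. -/
noncomputable def dvg (W : Fin n → Euc n → ℝ) : Euc n → ℝ := fun y => ∑ i, pd i (W i) y

section Calculus

variable {f g : Euc n → ℝ} {i j : Fin n} {y : Euc n}

lemma contDiff_pd (hf : ContDiff ℝ ∞ f) (i : Fin n) : ContDiff ℝ ∞ (pd i f) :=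
  (hf.fderiv_right (m := ∞) (by simp)).clm_apply contDiff_const

lemma contDiff_lap (hf : ContDiff ℝ ∞ f) : ContDiff ℝ ∞ (lap f) :=
  ContDiff.sum fun i _ => contDiff_pd (contDiff_pd hf i) i

lemma contDiff_dvg {W : Fin n → Euc n → ℝ} (hW : ∀ i, ContDiff ℝ ∞ (W i)) :
    ContDiff ℝ ∞ (dvg W) :=
  ContDiff.sum fun i _ => contDiff_pd (hW i) i

lemma differentiable_of_smooth (hf : ContDiff ℝ ∞ f) : Differentiable ℝ f :=
  hf.differentiable (by simp)

lemma pd_add (hf : ContDiff ℝ ∞ f) (hg : ContDiff ℝ ∞ g) :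
    pd i (fun y => f y + g y) = fun y => pd i f y + pd i g y := by
  funext y
  simp only [pd]
  rw [fderiv_fun_add (differentiable_of_smooth hf y) (differentiable_of_smooth hg y)]; rfl

lemma pd_sub (hf : ContDiff ℝ ∞ f) (hg : ContDiff ℝ ∞ g) :
    pd i (fun y => f y - g y) = fun y => pd i f y - pd i g y := by
  funext y
  simp only [pd]
  rw [fderiv_fun_sub (differentiable_of_smooth hf y) (differentiable_of_smooth hg y)]; rfl

lemma pd_mul (hf : ContDiff ℝ ∞ f) (hg : ContDiff ℝ ∞ g) :
    pd i (fun y => f y * g y) = fun y => pd i f y * g y + f y * pd i g y := by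
  funext y
  simp only [pd]
  rw [fderiv_fun_mul (differentiable_of_smooth hf y) (differentiable_of_smooth hg y)]
  simp only [_root_.add_apply, _root_.smul_apply, smul_eq_mul]
  ring

lemma pd_const_mul (c : ℝ) (hf : ContDiff ℝ ∞ f) :
    pd i (fun y => c * f y) = fun y => c * pd i f y := by
  funext y
  simp only [pd]
  rw [fderiv_const_mul (differentiable_of_smooth hf y)]; rfl

lemma pd_sum {ι : Type*} {s : Finset ι} {F : ι → Euc n → ℝ} (hF : ∀ a, ContDiff ℝ ∞ (F a)) :
    pd i (fun y => ∑ a ∈ s, F a y) = fun y => ∑ a ∈ s, pd i (F a) y := by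
  funext y
  simp only [pd]
  rw [fderiv_fun_sum (fun a _ => differentiable_of_smooth (hF a) y)]; simp

lemma pd_comm (hf : ContDiff ℝ ∞ f) : pd i (pd j f) = pd j (pd i f) := by
  funext y
  have hs : IsSymmSndFDerivAt ℝ f y :=
    hf.contDiffAt.isSymmSndFDerivAt
      (by rw [minSmoothness_of_isRCLikeNormedField]; exact WithTop.coe_le_coe.2 le_top)
  have hd : DifferentiableAt ℝ (fderiv ℝ f) y :=
    (hf.fderiv_right (m := ∞) (by simp)).differentiable (by simp) y
  have key : ∀ v w : Euc n, fderiv ℝ (fun z => fderiv ℝ f z v) y w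
      = fderiv ℝ (fderiv ℝ f) y w v := by
    intro v w
    rw [fderiv_clm_apply hd (differentiableAt_const v)]
    simp
  change fderiv ℝ (fun z => fderiv ℝ f z _) y _ = fderiv ℝ (fun z => fderiv ℝ f z _) y _
  rw [key, key]
  exact hs _ _

lemma pd_congr (h : f =ᶠ[𝓝 y] g) : pd i f =ᶠ[𝓝 y] pd i g :=
  (h.fderiv (𝕜 := ℝ)).mono fun z hz => by simp only [pd, hz]

lemma lap_congr (h : f =ᶠ[𝓝 y] g) : lap f =ᶠ[𝓝 y] lap g := by
  have : ∀ i : Fin n, pd i (pd i f) =ᶠ[𝓝 y] pd i (pd i g) := fun i => pd_congr (pd_congr h)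
  filter_upwards [eventually_all.2 this] with z hz
  simp only [lap, hz]

lemma dvg_congr {W Z : Fin n → Euc n → ℝ} (h : ∀ i, W i =ᶠ[𝓝 y] Z i) :
    dvg W =ᶠ[𝓝 y] dvg Z := by
  have : ∀ i : Fin n, pd i (W i) =ᶠ[𝓝 y] pd i (Z i) := fun i => pd_congr (h i)
  filter_upwards [eventually_all.2 this] with z hz
  simp only [dvg, hz]

lemma pd_const (c : ℝ) : pd i (fun _ : Euc n => c) = fun _ => 0 := by
  funext y; simp [pd]

lemma hasCompactSupport_pd (hf : HasCompactSupport f) : HasCompactSupport (pd i f) :=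
  hf.fderiv_apply ℝ _

lemma integral_pd_eq_zero (hf : ContDiff ℝ ∞ f) (hc : HasCompactSupport f) :
    ∫ y, pd i f y = 0 := by
  have h := integral_mul_fderiv_eq_neg_fderiv_mul_of_integrable (μ := (volume : Measure (Euc n)))
    (f := fun _ => (1 : ℝ)) (g := f) (v := EuclideanSpace.single i 1) (by simp) ?_ ?_
    (fun x _ => differentiableAt_const _) (fun x _ => differentiable_of_smooth hf x)
  · simpa [pd] using h
  · simp only [one_mul]
    exact (contDiff_pd hf i).continuous.integrable_of_hasCompactSupport (hasCompactSupport_pd hc)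
  · simp only [one_mul]
    exact hf.continuous.integrable_of_hasCompactSupport hc

/-- The norm of the `k`-th derivative. -/
noncomputable def dn (k : ℕ) (f : Euc n → ℝ) (y : Euc n) : ℝ := ‖iteratedFDeriv ℝ k f y‖

lemma dn_nonneg (k : ℕ) (f : Euc n → ℝ) (y : Euc n) : 0 ≤ dn k f y := norm_nonneg _

lemma dn_zero : dn 0 f y = |f y| := by simp [dn]

lemma dn_pd_le (hf : ContDiff ℝ ∞ f) (k : ℕ) : dn k (pd i f) y ≤ dn (k + 1) f y := by
  have hf' : ContDiff ℝ ∞ (fderiv ℝ f) := hf.fderiv_right (m := ∞) (by simp)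
  have h := norm_iteratedFDeriv_clm_apply_const (f := fderiv ℝ f)
    (c := (EuclideanSpace.single i 1 : Euc n)) (x := y) (n := k) (N := ∞)
    hf'.contDiffAt (mod_cast le_top)
  have e : pd i f = fun y => fderiv ℝ f y (EuclideanSpace.single i 1) := rfl
  simpa [norm_iteratedFDeriv_fderiv, dn, e] using h

lemma abs_pd_le (hf : ContDiff ℝ ∞ f) : |pd i f y| ≤ dn 1 f y := by
  simpa [dn_zero] using dn_pd_le (i := i) (y := y) hf 0

lemma abs_pd_pd_le (hf : ContDiff ℝ ∞ f) : |pd i (pd j f) y| ≤ dn 2 f y :=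
  (abs_pd_le (contDiff_pd hf j)).trans (dn_pd_le hf 1)

lemma abs_pd_pd_pd_le (hf : ContDiff ℝ ∞ f) (i j k : Fin n) :
    |pd i (pd j (pd k f)) y| ≤ dn 3 f y :=
  (abs_pd_pd_le (contDiff_pd hf k)).trans (dn_pd_le hf 2)

lemma dn_congr (h : f =ᶠ[𝓝 y] g) (k : ℕ) : dn k f y = dn k g y := by
  have := (h.iteratedFDeriv ℝ k).eq_of_nhds
  simp only [dn, this]

lemma dn_sub_le (hf : ContDiff ℝ ∞ f) (hg : ContDiff ℝ ∞ g) (k : ℕ) :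
    dn k (fun y => f y - g y) y ≤ dn k f y + dn k g y := by
  have : iteratedFDeriv ℝ k (fun y => f y - g y) y
      = iteratedFDeriv ℝ k f y - iteratedFDeriv ℝ k g y := by
    exact iteratedFDeriv_sub_apply (hf.of_le (mod_cast le_top)).contDiffAt
      (hg.of_le (mod_cast le_top)).contDiffAt
  simp only [dn, this]
  exact norm_sub_le _ _

/-- `f` is a symbol of size `A` at scale `r` at the point `y`, up to three derivatives. -/
def Symb (f : Euc n → ℝ) (A r : ℝ) (y : Euc n) : Prop :=
  ∀ k ≤ 3, dn k f y ≤ A / r ^ k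

lemma Symb.mul {A B r : ℝ} (hr : 0 < r) (hf : ContDiff ℝ ∞ f) (hg : ContDiff ℝ ∞ g)
    (h1 : Symb f A r y) (h2 : Symb g B r y) : Symb (fun y => f y * g y) (8 * A * B) r y := by
  intro k hk
  have hA : 0 ≤ A := by simpa using (dn_nonneg 0 f y).trans (h1 0 (by simp))
  have hB : 0 ≤ B := by simpa using (dn_nonneg 0 g y).trans (h2 0 (by simp))
  have h := norm_iteratedFDeriv_mul_le (N := ∞) hf hg y (n := k) (mod_cast le_top)
  refine h.trans ?_
  have : ∀ l ∈ Finset.range (k + 1), (k.choose l : ℝ) * ‖iteratedFDeriv ℝ l f y‖ *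
      ‖iteratedFDeriv ℝ (k - l) g y‖ ≤ (k.choose l : ℝ) * (A * B / r ^ k) := by
    intro l hl
    have hl' : l ≤ k := by simpa [Nat.lt_succ_iff] using hl
    have e : A * B / r ^ k = (A / r ^ l) * (B / r ^ (k - l)) := by
      rw [div_mul_div_comm, ← pow_add, Nat.add_sub_cancel' hl']
    rw [mul_assoc, e]
    gcongr
    · exact h1 l (hl'.trans hk)
    · exact h2 (k - l) ((Nat.sub_le _ _).trans hk)
  refine (Finset.sum_le_sum this).trans ?_
  rw [← Finset.sum_mul]
  have h3 : (∑ l ∈ Finset.range (k + 1), (k.choose l : ℝ)) = 2 ^ k := by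
    exact_mod_cast Nat.sum_range_choose k
  rw [h3, mul_assoc 8, mul_div_assoc 8]
  have h4 : (2 : ℝ) ^ k ≤ 8 := (pow_le_pow_right₀ (by norm_num) hk).trans (by norm_num)
  exact mul_le_mul_of_nonneg_right h4 (div_nonneg (mul_nonneg hA hB) (by positivity))

end Calculus

section WeakForm

lemma pd_eq_zero_of_isOpen {f : Euc n → ℝ} {U : Set (Euc n)} (hU : IsOpen U)
    (hf : ∀ y ∈ U, f y = 0) (i : Fin n) : ∀ y ∈ U, pd i f y = 0 := by
  intro y hy
  have h : f =ᶠ[𝓝 y] fun _ => (0 : ℝ) := by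
    filter_upwards [hU.mem_nhds hy] with z hz using hf z hz
  rw [(pd_congr (i := i) h).eq_of_nhds, pd_const]

lemma lap_eq_zero_of_isOpen {f : Euc n → ℝ} {U : Set (Euc n)} (hU : IsOpen U)
    (hf : ∀ y ∈ U, f y = 0) : ∀ y ∈ U, lap f y = 0 := fun y hy =>
  Finset.sum_eq_zero fun i _ =>
    pd_eq_zero_of_isOpen hU (pd_eq_zero_of_isOpen hU hf i) i y hy

lemma isOpen_norm_gt (ρ : ℝ) : IsOpen {y : Euc n | ρ < ‖y‖} :=
  isOpen_lt continuous_const continuous_norm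

lemma isOpen_norm_lt (ρ : ℝ) : IsOpen {y : Euc n | ‖y‖ < ρ} :=
  isOpen_lt continuous_norm continuous_const

lemma hasCompactSupport_of_norm {f : Euc n → ℝ} {ρ : ℝ} (hf : ∀ y, ρ < ‖y‖ → f y = 0) :
    HasCompactSupport f :=
  HasCompactSupport.intro (isCompact_closedBall (0 : Euc n) ρ) fun y hy =>
    hf y (by simpa using hy)

lemma integral_dvg_eq_zero {F : Fin n → Euc n → ℝ} {ρ : ℝ} (hF : ∀ i, ContDiff ℝ ∞ (F i))
    (h0 : ∀ i y, ρ < ‖y‖ → F i y = 0) : ∫ y, dvg F y = 0 := by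
  have hc : ∀ i, HasCompactSupport (F i) := fun i => hasCompactSupport_of_norm (h0 i)
  simp only [dvg]
  rw [integral_finsetSum]
  · exact Finset.sum_eq_zero fun i _ => integral_pd_eq_zero (hF i) (hc i)
  · exact fun i _ => (contDiff_pd (hF i) i).continuous.integrable_of_hasCompactSupport
      (hasCompactSupport_pd (hc i))

/-- The steady momentum equations at a point, in components. -/
def Momentum (u : Fin n → Euc n → ℝ) (p : Euc n → ℝ) (y : Euc n) : Prop :=
  ∀ j, -lap (u j) y + (∑ i, u i y * pd i (u j) y) + pd j p y = 0

lemma weak_form {u φ : Fin n → Euc n → ℝ} {p g : Euc n → ℝ} {ρ : ℝ}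
    (hu : ∀ j, ContDiff ℝ ∞ (u j)) (hp : ContDiff ℝ ∞ p)
    (hφ : ∀ j, ContDiff ℝ ∞ (φ j)) (hg : ContDiff ℝ ∞ g)
    (hφρ : ∀ j y, ρ < ‖y‖ → φ j y = 0) (hgρ : ∀ y, ρ < ‖y‖ → g y = 0)
    (hdiv : ∀ y, dvg φ y = 0)
    (heq : ∀ y, (g y = 0 ∧ ∀ j, φ j y = 0) ∨ (Momentum u p y ∧ dvg u y = 0)) :
    ∫ y, ∑ j, (u j y * (lap (φ j) y + pd j g y) + ∑ i, u i y * u j y * pd i (φ j) y) = 0 := by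
  set G : Fin n → Fin n → Euc n → ℝ := fun i j y =>
    (u j y * pd i (φ j) y - pd i (u j) y * φ j y) + u i y * (u j y * φ j y) with hG
  set F : Fin n → Euc n → ℝ := fun i y => (∑ j, G i j y) + (p y * φ i y + u i y * g y) with hF
  have hpu : ∀ i j, ContDiff ℝ ∞ (pd i (u j)) := fun i j => contDiff_pd (hu j) i
  have hpφ : ∀ i j, ContDiff ℝ ∞ (pd i (φ j)) := fun i j => contDiff_pd (hφ j) i
  have hGs : ∀ i j, ContDiff ℝ ∞ (G i j) := fun i j =>
    (((hu j).mul (hpφ i j)).sub ((hpu i j).mul (hφ j))).add ((hu i).mul ((hu j).mul (hφ j)))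
  have hFs : ∀ i, ContDiff ℝ ∞ (F i) := fun i =>
    (ContDiff.sum fun j _ => hGs i j).add ((hp.mul (hφ i)).add ((hu i).mul hg))
  have hF0 : ∀ i y, ρ < ‖y‖ → F i y = 0 := by
    intro i y hy
    have h1 : ∀ j, pd i (φ j) y = 0 := fun j =>
      pd_eq_zero_of_isOpen (isOpen_norm_gt ρ) (hφρ j) i y hy
    simp [hF, hG, h1, hφρ _ y hy, hgρ y hy]
  have hpdG : ∀ i j y, pd i (G i j) y = (u j y * pd i (pd i (φ j)) y + u i y * u j y * pd i (φ j) y)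
      + φ j y * (-pd i (pd i (u j)) y + u i y * pd i (u j) y) + pd i (u i) y * (u j y * φ j y) := by
    intro i j y
    simp only [hG]
    rw [pd_add (((hu j).mul (hpφ i j)).sub ((hpu i j).mul (hφ j)))
      ((hu i).mul ((hu j).mul (hφ j))), pd_sub ((hu j).mul (hpφ i j)) ((hpu i j).mul (hφ j)),
      pd_mul (hu j) (hpφ i j), pd_mul (hpu i j) (hφ j), pd_mul (hu i) ((hu j).mul (hφ j)),
      pd_mul (hu j) (hφ j)]
    ring
  have hpdF : ∀ i y, pd i (F i) y = (∑ j, pd i (G i j) y) +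
      ((pd i p y * φ i y + p y * pd i (φ i) y) + (pd i (u i) y * g y + u i y * pd i g y)) := by
    intro i y
    simp only [hF]
    rw [pd_add (ContDiff.sum fun j _ => hGs i j) ((hp.mul (hφ i)).add ((hu i).mul hg)),
      pd_add (hp.mul (hφ i)) ((hu i).mul hg), pd_mul hp (hφ i), pd_mul (hu i) hg,
      pd_sum (fun j => hGs i j)]
  have hpt : ∀ y, dvg F y =
      ∑ j, (u j y * (lap (φ j) y + pd j g y) + ∑ i, u i y * u j y * pd i (φ j) y) := by
    intro y
    have e1 : dvg F y =
        (∑ j, (u j y * (lap (φ j) y + pd j g y) + ∑ i, u i y * u j y * pd i (φ j) y))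
        + (∑ j, φ j y * (-lap (u j) y + (∑ i, u i y * pd i (u j) y) + pd j p y))
        + p y * dvg φ y + dvg u y * (∑ j, u j y * φ j y) + dvg u y * g y := by
      simp only [dvg, hpdF, hpdG, Finset.sum_add_distrib]
      have c1 : ∑ i, ∑ j, u j y * pd i (pd i (φ j)) y = ∑ j, u j y * lap (φ j) y := by
        rw [Finset.sum_comm]; simp only [lap, Finset.mul_sum]
      have c2 : ∑ i, ∑ j, u i y * u j y * pd i (φ j) y
          = ∑ j, ∑ i, u i y * u j y * pd i (φ j) y := Finset.sum_comm
      have c3 : ∑ i, ∑ j, φ j y * (-pd i (pd i (u j)) y + u i y * pd i (u j) y)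
          = ∑ j, φ j y * (-lap (u j) y + ∑ i, u i y * pd i (u j) y) := by
        rw [Finset.sum_comm]
        simp only [lap, ← Finset.mul_sum, Finset.sum_add_distrib, Finset.sum_neg_distrib]
      have c4 : ∑ i, ∑ j, pd i (u i) y * (u j y * φ j y)
          = (∑ i, pd i (u i) y) * ∑ j, u j y * φ j y := by
        rw [Finset.sum_mul_sum]
      have c5 : ∑ j, φ j y * (-lap (u j) y + (∑ i, u i y * pd i (u j) y) + pd j p y)
          = ∑ j, φ j y * (-lap (u j) y + ∑ i, u i y * pd i (u j) y) + ∑ j, pd j p y * φ j y := by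
        rw [← Finset.sum_add_distrib]
        exact Finset.sum_congr rfl fun j _ => by ring
      have c6 : ∑ j, u j y * (lap (φ j) y + pd j g y)
          = ∑ j, u j y * lap (φ j) y + ∑ j, u j y * pd j g y := by
        rw [← Finset.sum_add_distrib]
        exact Finset.sum_congr rfl fun j _ => by ring
      rw [c1, c2, c3, c4, c5, c6, ← Finset.mul_sum, ← Finset.sum_mul]
      ring
    rw [e1, hdiv y]
    rcases heq y with ⟨h1, h2⟩ | ⟨h1, h2⟩
    · simp [h1, h2]
    · have : ∀ j, φ j y * (-lap (u j) y + (∑ i, u i y * pd i (u j) y) + pd j p y) = 0 := by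
        intro j; rw [h1 j, mul_zero]
      simp only [this, h2]
      simp
  rw [← integral_dvg_eq_zero hFs hF0]
  exact integral_congr_ae (Eventually.of_forall fun y => (hpt y).symm)

end WeakForm

section Kernel

/-- The regularised power `(‖y - x‖² + δ²) ^ s`. -/
noncomputable def regPow (δ : ℝ) (x : Euc n) (s : ℝ) : Euc n → ℝ :=
  fun y => (‖y - x‖ ^ 2 + δ ^ 2) ^ s

/-- The regularised gradient of the fundamental solution of the bilaplacian (up to a constant). -/
noncomputable def gradBi (δ : ℝ) (x : Euc n) (i : Fin n) : Euc n → ℝ :=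
  fun y => (y i - x i) * regPow δ x (-(((n : ℝ) - 2) / 2)) y

variable {δ : ℝ} {x y : Euc n} {s : ℝ} {i j : Fin n}

lemma reg_pos (hδ : 0 < δ) (x y : Euc n) : 0 < ‖y - x‖ ^ 2 + δ ^ 2 := by positivity

lemma contDiff_coord (x : Euc n) (i : Fin n) : ContDiff ℝ ∞ (fun y : Euc n => y i - x i) :=
  (contDiff_piLp_apply (p := 2)).sub contDiff_const

lemma contDiff_reg (δ : ℝ) (x : Euc n) :
    ContDiff ℝ ∞ (fun y : Euc n => ‖y - x‖ ^ 2 + δ ^ 2) :=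
  ((contDiff_id.sub contDiff_const).norm_sq ℝ).add contDiff_const

lemma contDiff_regPow (hδ : 0 < δ) (x : Euc n) (s : ℝ) : ContDiff ℝ ∞ (regPow δ x s) :=
  (contDiff_reg δ x).rpow_const_of_ne fun y => (reg_pos hδ x y).ne'

lemma contDiff_gradBi (hδ : 0 < δ) (x : Euc n) (i : Fin n) : ContDiff ℝ ∞ (gradBi δ x i) :=
  (contDiff_coord x i).mul (contDiff_regPow hδ x _)

lemma pd_coord (x : Euc n) (i j : Fin n) :
    pd i (fun y : Euc n => y j - x j) = fun _ => if i = j then 1 else 0 := by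
  funext y
  have h : HasFDerivAt (fun y : Euc n => y j - x j)
      (EuclideanSpace.proj j : Euc n →L[ℝ] ℝ) y :=
    ((EuclideanSpace.proj j : Euc n →L[ℝ] ℝ).hasFDerivAt).sub_const _
  simp only [pd, h.fderiv]
  simp [eq_comm]

lemma pd_regPow (hδ : 0 < δ) (x : Euc n) (s : ℝ) (i : Fin n) :
    pd i (regPow δ x s) = fun y => 2 * s * ((y i - x i) * regPow δ x (s - 1) y) := by
  funext y
  have h0 : HasFDerivAt (fun y : Euc n => y - x) (ContinuousLinearMap.id ℝ (Euc n)) y :=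
    (hasFDerivAt_id y).sub_const x
  have h1 := (h0.norm_sq.add_const (δ ^ 2)).rpow_const (p := s) (Or.inl (reg_pos hδ x y).ne')
  have h2 : HasFDerivAt (regPow δ x s) _ y := h1
  simp only [pd, h2.fderiv]
  simp [regPow, EuclideanSpace.inner_single_right]
  ring

lemma regPow_succ (hδ : 0 < δ) (x y : Euc n) (s : ℝ) :
    regPow δ x (s + 1) y = (‖y - x‖ ^ 2 + δ ^ 2) * regPow δ x s y := by
  simp only [regPow]
  rw [Real.rpow_add_one (reg_pos hδ x y).ne']; ring

lemma sum_coord_sq (x y : Euc n) : ∑ i, (y i - x i) * (y i - x i) = ‖y - x‖ ^ 2 := by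
  rw [EuclideanSpace.real_norm_sq_eq]
  exact Finset.sum_congr rfl fun i _ => by simp [sq]

lemma pd_coord_mul_regPow (hδ : 0 < δ) (x : Euc n) (s : ℝ) (i j : Fin n) :
    pd i (fun y => (y j - x j) * regPow δ x s y) = fun y =>
      (if i = j then 1 else 0) * regPow δ x s y
        + 2 * s * ((y i - x i) * (y j - x j) * regPow δ x (s - 1) y) := by
  rw [pd_mul (contDiff_coord x j) (contDiff_regPow hδ x s), pd_coord, pd_regPow hδ]
  funext y
  ring

lemma pd_gradBi_symm (hδ : 0 < δ) (x : Euc n) (i j : Fin n) :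
    pd i (gradBi δ x j) = pd j (gradBi δ x i) := by
  unfold gradBi
  rw [pd_coord_mul_regPow hδ, pd_coord_mul_regPow hδ]
  funext y
  have : (if i = j then (1 : ℝ) else 0) = if j = i then 1 else 0 := by simp [eq_comm]
  rw [this]; ring

lemma sum_pd_coord_mul_regPow (hδ : 0 < δ) (x : Euc n) (s : ℝ) (y : Euc n) :
    ∑ i, pd i (fun y => (y i - x i) * regPow δ x s y) y =
      (n + 2 * s) * regPow δ x s y - 2 * s * δ ^ 2 * regPow δ x (s - 1) y := by
  simp only [pd_coord_mul_regPow hδ, if_true, one_mul, Finset.sum_add_distrib, ← Finset.mul_sum,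
    ← Finset.sum_mul, sum_coord_sq]
  have h := regPow_succ hδ x y (s - 1)
  rw [sub_add_cancel] at h
  simp only [Finset.sum_const, Finset.card_univ, Fintype.card_fin, nsmul_eq_mul]
  rw [h]; ring

lemma lap_regPow (hδ : 0 < δ) (x : Euc n) (s : ℝ) (y : Euc n) :
    lap (regPow δ x s) y = 2 * s * ((n + 2 * (s - 1)) * regPow δ x (s - 1) y
      - 2 * (s - 1) * δ ^ 2 * regPow δ x (s - 2) y) := by
  have h : ∀ i, pd i (pd i (regPow δ x s)) y
      = 2 * s * pd i (fun y => (y i - x i) * regPow δ x (s - 1) y) y := by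
    intro i
    rw [pd_regPow hδ, pd_const_mul _ ((contDiff_coord x i).mul (contDiff_regPow hδ x _))]
  simp only [lap, h, ← Finset.mul_sum, sum_pd_coord_mul_regPow hδ]
  rw [show s - 1 - 1 = s - 2 by ring]

lemma lap_add {f g : Euc n → ℝ} (hf : ContDiff ℝ ∞ f) (hg : ContDiff ℝ ∞ g) :
    lap (fun y => f y + g y) = fun y => lap f y + lap g y := by
  funext y
  simp only [lap, pd_add hf hg, pd_add (contDiff_pd hf _) (contDiff_pd hg _),
    Finset.sum_add_distrib]

lemma lap_sub {f g : Euc n → ℝ} (hf : ContDiff ℝ ∞ f) (hg : ContDiff ℝ ∞ g) :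
    lap (fun y => f y - g y) = fun y => lap f y - lap g y := by
  funext y
  simp only [lap, pd_sub hf hg, pd_sub (contDiff_pd hf _) (contDiff_pd hg _),
    Finset.sum_sub_distrib]

lemma lap_const_mul {f : Euc n → ℝ} (c : ℝ) (hf : ContDiff ℝ ∞ f) :
    lap (fun y => c * f y) = fun y => c * lap f y := by
  funext y
  simp only [lap, pd_const_mul c hf, pd_const_mul c (contDiff_pd hf _), Finset.mul_sum]

lemma dvg_gradBi (hδ : 0 < δ) (x : Euc n) :
    dvg (gradBi δ x) = fun y => 2 * regPow δ x (-(((n : ℝ) - 2) / 2)) y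
      + ((n - 2) * δ ^ 2) * regPow δ x (-((n : ℝ) / 2)) y := by
  funext y
  unfold gradBi
  simp only [dvg, sum_pd_coord_mul_regPow hδ]
  rw [show -(((n : ℝ) - 2) / 2) - 1 = -((n : ℝ) / 2) by ring]
  ring

/-- The regularised kernel approximates a multiple of the fundamental solution of `Δ²`. -/
lemma lap_dvg_gradBi (hδ : 0 < δ) (x y : Euc n) :
    lap (dvg (gradBi δ x)) y =
      -((n - 2) * n * (n + 2) * (δ ^ 4 * regPow δ x (-((n : ℝ) / 2) - 2) y)) := by
  rw [dvg_gradBi hδ, lap_add (contDiff_const.mul (contDiff_regPow hδ x _))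
    (contDiff_const.mul (contDiff_regPow hδ x _)), lap_const_mul _ (contDiff_regPow hδ x _),
    lap_const_mul _ (contDiff_regPow hδ x _)]
  simp only [lap_regPow hδ]
  rw [show -(((n : ℝ) - 2) / 2) - 1 = -((n : ℝ) / 2) by ring,
    show -(((n : ℝ) - 2) / 2) - 2 = -((n : ℝ) / 2) - 1 by ring]
  ring

lemma Symb.const (c : ℝ) {r : ℝ} (hr : 0 < r) (y : Euc n) : Symb (fun _ => c) |c| r y := by
  intro k _
  rcases k with _ | k
  · simp [dn_zero]
  · simp only [dn, iteratedFDeriv_succ_const, Pi.zero_apply, norm_zero]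
    positivity

lemma Symb.mono {f : Euc n → ℝ} {A B r : ℝ} (hr : 0 < r) (h : Symb f A r y) (hAB : A ≤ B) :
    Symb f B r y := fun k hk => (h k hk).trans (by gcongr)

lemma Symb.mono_scale {f : Euc n → ℝ} {A r t : ℝ} (hr : 0 < r) (hrt : r ≤ t)
    (h : Symb f A t y) : Symb f A r y := by
  intro k hk
  have hA : 0 ≤ A := by simpa using (dn_nonneg 0 f y).trans (h 0 (by simp))
  exact (h k hk).trans (by gcongr)

lemma Symb.const_mul {f : Euc n → ℝ} {A r : ℝ} (hr : 0 < r) (hf : ContDiff ℝ ∞ f)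
    (h : Symb f A r y) (c : ℝ) : Symb (fun y => c * f y) (8 * |c| * A) r y :=
  Symb.mul hr contDiff_const hf (Symb.const c hr y) h

lemma Symb.sum {ι : Type*} (t : Finset ι) {f : ι → Euc n → ℝ} {A : ι → ℝ} {r : ℝ}
    (hf : ∀ a, ContDiff ℝ ∞ (f a)) (h : ∀ a, Symb (f a) (A a) r y) :
    Symb (fun y => ∑ a ∈ t, f a y) (∑ a ∈ t, A a) r y := by
  intro k hk
  have e : iteratedFDeriv ℝ k (fun y => ∑ a ∈ t, f a y) y
      = ∑ a ∈ t, iteratedFDeriv ℝ k (f a) y :=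
    iteratedFDeriv_fun_sum_apply fun a _ => ((hf a).of_le (mod_cast le_top)).contDiffAt
  simp only [dn, e, Finset.sum_div]
  exact (norm_sum_le _ _).trans (Finset.sum_le_sum fun a _ => h a k hk)

lemma Symb.add {f g : Euc n → ℝ} {A B r : ℝ}
    (hf : ContDiff ℝ ∞ f) (hg : ContDiff ℝ ∞ g) (h1 : Symb f A r y) (h2 : Symb g B r y) :
    Symb (fun y => f y + g y) (A + B) r y := by
  intro k hk
  have e : iteratedFDeriv ℝ k (fun y => f y + g y) y
      = iteratedFDeriv ℝ k f y + iteratedFDeriv ℝ k g y :=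
    iteratedFDeriv_add_apply (hf.of_le (mod_cast le_top)).contDiffAt
      (hg.of_le (mod_cast le_top)).contDiffAt
  simp only [dn, e, add_div]
  exact (norm_add_le _ _).trans (add_le_add (h1 k hk) (h2 k hk))

lemma symb_coord {r : ℝ} (hr : 0 < r) (hy : ‖y - x‖ ≤ r) (i : Fin n) :
    Symb (fun y : Euc n => y i - x i) r r y := by
  set L : Euc n →L[ℝ] ℝ := EuclideanSpace.proj i with hL
  have hfd : fderiv ℝ (fun y : Euc n => y i - x i) = fun _ => L := by
    funext z
    have h : HasFDerivAt (fun y : Euc n => y i - x i) L z := L.hasFDerivAt.sub_const _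
    exact h.fderiv
  have hLn : ‖L‖ ≤ 1 := L.opNorm_le_bound zero_le_one fun z => by
    simpa [hL] using PiLp.norm_apply_le z i
  intro k _
  rcases k with _ | k
  · simpa [dn_zero] using (PiLp.norm_apply_le (y - x) i).trans hy
  · simp only [dn]
    rw [← norm_iteratedFDeriv_fderiv, hfd]
    rcases k with _ | k
    · simp only [norm_iteratedFDeriv_zero]
      rwa [zero_add, pow_one, div_self hr.ne']
    · simp only [iteratedFDeriv_succ_const, Pi.zero_apply, norm_zero]
      positivity

lemma symb_reg (hδ : 0 < δ) (x y : Euc n) :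
    Symb (fun y : Euc n => ‖y - x‖ ^ 2 + δ ^ 2) ((8 * n + 1) * (‖y - x‖ ^ 2 + δ ^ 2))
      (√(‖y - x‖ ^ 2 + δ ^ 2)) y := by
  set r := √(‖y - x‖ ^ 2 + δ ^ 2) with hr
  have hr2 : r ^ 2 = ‖y - x‖ ^ 2 + δ ^ 2 := Real.sq_sqrt (reg_pos hδ x y).le
  have hr0 : 0 < r := Real.sqrt_pos.2 (reg_pos hδ x y)
  have hyr : ‖y - x‖ ≤ r := by
    apply Real.le_sqrt_of_sq_le
    nlinarith [sq_nonneg δ]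
  have hs : ∀ i, ContDiff ℝ ∞ fun y : Euc n => (y i - x i) * (y i - x i) := fun i =>
    (contDiff_coord x i).mul (contDiff_coord x i)
  have h1 := Symb.sum (y := y) Finset.univ hs
    (fun i => Symb.mul hr0 (contDiff_coord x i) (contDiff_coord x i) (symb_coord hr0 hyr i)
      (symb_coord hr0 hyr i))
  have h2 := Symb.add (ContDiff.sum fun i _ => hs i) (contDiff_const (c := δ ^ 2)) h1
    (Symb.const (δ ^ 2) hr0 y)
  simp only [sum_coord_sq] at h2
  refine h2.mono hr0 ?_
  rw [abs_of_nonneg (sq_nonneg δ)]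
  simp only [Finset.sum_const, Finset.card_univ, Fintype.card_fin, nsmul_eq_mul]
  rw [← hr2]
  have : δ ^ 2 ≤ r ^ 2 := by rw [hr2]; nlinarith [sq_nonneg ‖y - x‖]
  nlinarith

lemma exists_symb_regPow (n : ℕ) (s : ℝ) : ∃ C : ℝ, 0 < C ∧ ∀ (δ : ℝ) (x y : Euc n), 0 < δ →
    Symb (regPow δ x s) (C * regPow δ x s y) (√(‖y - x‖ ^ 2 + δ ^ 2)) y := by
  set g : ℝ → ℝ := fun t => t ^ s with hg
  set M : ℝ := ∑ k ∈ Finset.range 4, ‖iteratedFDeriv ℝ k g 1‖ with hM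
  have hM0 : 0 ≤ M := Finset.sum_nonneg fun k _ => norm_nonneg _
  have hMk : ∀ k ≤ 3, ‖iteratedFDeriv ℝ k g 1‖ ≤ M := fun k hk =>
    Finset.single_le_sum (f := fun k => ‖iteratedFDeriv ℝ k g 1‖) (fun k _ => norm_nonneg _)
      (by simp; omega)
  set D : ℝ := 8 * (8 * n + 1) with hD
  have hD1 : 1 ≤ D := by rw [hD]; nlinarith [(Nat.cast_nonneg n : (0 : ℝ) ≤ n)]
  refine ⟨8 * (6 * M * D ^ 3 + 1), by positivity, ?_⟩
  intro δ x y hδ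
  have hρ := reg_pos hδ x y
  set ρ := ‖y - x‖ ^ 2 + δ ^ 2 with hρdef
  set r := √ρ with hr
  have hr0 : 0 < r := Real.sqrt_pos.2 hρ
  set f : Euc n → ℝ := fun z => ρ⁻¹ * (‖z - x‖ ^ 2 + δ ^ 2) with hf
  have hfs : ContDiff ℝ ∞ f := contDiff_const.mul (contDiff_reg δ x)
  have hfy : f y = 1 := by simp only [hf]; rw [← hρdef]; exact inv_mul_cancel₀ hρ.ne'
  have hfpos : ∀ z, 0 < f z := fun z => mul_pos (inv_pos.2 hρ) (reg_pos hδ x z)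
  have hfsy : Symb f D r y := by
    refine ((symb_reg hδ x y).const_mul hr0 (contDiff_reg δ x) ρ⁻¹).mono hr0 ?_
    rw [abs_of_pos (inv_pos.2 hρ), ← hρdef, hD]
    apply le_of_eq
    field_simp
  have hcomp : Symb (fun z => (f z) ^ s) (6 * M * D ^ 3 + 1) r y := by
    intro k hk
    have h := norm_iteratedFDeriv_comp_le' (𝕜 := ℝ) (g := g) (f := f) (n := k) (N := ∞)
      (t := Set.Ioi 0) (by rintro _ ⟨z, rfl⟩; exact hfpos z) isOpen_Ioi.uniqueDiffOn
      (fun t ht => (contDiffAt_id.rpow_const_of_ne (ne_of_gt ht)).contDiffWithinAt)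
      hfs (mod_cast le_top) y (C := M) (D := D / r)
      (fun i hi => by
        rw [iteratedFDerivWithin_of_isOpen i isOpen_Ioi (hfpos y), hfy]
        exact hMk i (hi.trans hk))
      (fun i hi1 hik => by
        refine (hfsy i (hik.trans hk)).trans ?_
        rw [div_pow]
        gcongr
        exact le_self_pow₀ hD1 (by omega))
    refine (show dn k _ y ≤ _ from h).trans ?_
    rw [div_pow, mul_div_assoc']
    gcongr
    have h6 : (k.factorial : ℝ) ≤ 6 := by
      exact_mod_cast (Nat.factorial_le hk)
    have hDk : D ^ k ≤ D ^ 3 := pow_le_pow_right₀ hD1 hk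
    calc (k.factorial : ℝ) * M * D ^ k ≤ 6 * M * D ^ 3 := by gcongr
      _ ≤ _ := by linarith
  have hfc : ContDiff ℝ ∞ fun z => (f z) ^ s := hfs.rpow_const_of_ne fun z => (hfpos z).ne'
  have e : regPow δ x s = fun z => ρ ^ s * (f z) ^ s := by
    funext z
    simp only [regPow, hf]
    rw [← Real.mul_rpow hρ.le (hfpos z).le, mul_inv_cancel_left₀ hρ.ne']
  have hPy : regPow δ x s y = ρ ^ s := rfl
  rw [hPy, e]
  refine (hcomp.const_mul hr0 hfc (ρ ^ s)).mono hr0 (le_of_eq ?_)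
  rw [abs_of_pos (Real.rpow_pos_of_pos hρ s)]; ring

/-- Derivatives of the regularised kernel, uniformly in the regularisation parameter. -/
lemma exists_symb_gradBi (hn : 4 ≤ n) : ∃ C : ℝ, 0 < C ∧ ∀ (δ : ℝ) (x y : Euc n) (i : Fin n),
    0 < δ → y ≠ x → Symb (gradBi δ x i) (C / ‖y - x‖ ^ (n - 3)) ‖y - x‖ y := by
  obtain ⟨C, hC, h⟩ := exists_symb_regPow n (-(((n : ℝ) - 2) / 2))
  refine ⟨8 * C, by positivity, fun δ x y i hδ hyx => ?_⟩
  have hρ := reg_pos hδ x y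
  have h := h δ x y hδ
  set ρ := ‖y - x‖ ^ 2 + δ ^ 2 with hρdef
  set r := √ρ with hr
  have hr0 : 0 < r := Real.sqrt_pos.2 hρ
  have hd : 0 < ‖y - x‖ := norm_pos_iff.2 (sub_ne_zero.2 hyx)
  have hdr : ‖y - x‖ ≤ r := by
    apply Real.le_sqrt_of_sq_le
    rw [hρdef]; nlinarith [sq_nonneg δ]
  have h1 := Symb.mul hr0 (contDiff_coord x i) (contDiff_regPow hδ x _) (symb_coord hr0 hdr i) h
  refine (h1.mono hr0 ?_).mono_scale hd hdr
  have e : regPow δ x (-(((n : ℝ) - 2) / 2)) y = (r ^ (n - 2))⁻¹ := by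
    simp only [regPow]
    rw [← hρdef, Real.rpow_neg hρ.le, ← Real.rpow_natCast r, hr, Real.sqrt_eq_rpow,
      ← Real.rpow_mul hρ.le, Nat.cast_sub (by omega)]
    congr 2; push_cast; ring
  have e2 : r ^ (n - 2) = r * r ^ (n - 3) := by
    rw [← pow_succ']; congr 1; omega
  rw [e, e2]
  calc 8 * r * (C * (r * r ^ (n - 3))⁻¹) = 8 * C / r ^ (n - 3) := by field_simp
    _ ≤ 8 * C / ‖y - x‖ ^ (n - 3) := by gcongr

end Kernel

section Potential

lemma integrable_indicator_norm_inv {b : ℕ} (hn : 1 ≤ n) (hb : b ≤ n - 1) :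
    Integrable ((ball (0 : Euc n) 1).indicator fun y => (‖y‖ ^ b)⁻¹) := by
  have : Nontrivial (Euc n) := by
    have : NeZero n := ⟨by omega⟩
    infer_instance
  rw [integrable_indicator_iff measurableSet_ball]
  rw [integrableOn_fun_norm_addHaar (μ := (volume : Measure (Euc n))) (f := fun t : ℝ => (t ^ b)⁻¹)]
  have h : IntegrableOn (fun _ : ℝ => (1 : ℝ)) (Set.Ioo 0 1) := by
    simp
  refine Integrable.mono' h (by fun_prop) ?_
  rw [ae_restrict_iff' measurableSet_Ioo]
  refine Eventually.of_forall fun t ht => ?_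
  rw [finrank_euclideanSpace_fin, smul_eq_mul, ← div_eq_mul_inv,
    Real.norm_of_nonneg (div_nonneg (pow_nonneg ht.1.le _) (pow_nonneg ht.1.le _)),
    div_le_one (pow_pos ht.1 _)]
  exact pow_le_pow_of_le_one ht.1.le ht.2.le hb

/-- The Riesz potential integrand. -/
noncomputable def potK (n b : ℕ) (x y : Euc n) : ℝ := (‖y‖ ^ b)⁻¹ * (‖y - x‖ ^ (n - 1))⁻¹

lemma potK_nonneg (b : ℕ) (x y : Euc n) : 0 ≤ potK n b x y := by
  unfold potK; positivity

lemma measurable_potK (b : ℕ) (x : Euc n) : Measurable (potK n b x) := by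
  unfold potK; fun_prop

lemma potK_unit_bound {b : ℕ} {x : Euc n} (hx : ‖x‖ = 1) (y : Euc n) :
    potK n b x y ≤ 2 ^ (n - 1) * (ball (0 : Euc n) 1).indicator (fun y => (‖y‖ ^ b)⁻¹) y
      + 2 ^ b * (ball (0 : Euc n) 1).indicator (fun y => (‖y‖ ^ (n - 1))⁻¹) (y - x)
      + 3 ^ b * 5 ^ (n - 1) * (1 + ‖y‖) ^ (-((b + (n - 1) : ℕ) : ℝ)) := by
  have i1 : 0 ≤ (ball (0 : Euc n) 1).indicator (fun y => (‖y‖ ^ b)⁻¹) y :=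
    Set.indicator_nonneg (fun z _ => by positivity) _
  have i2 : 0 ≤ (ball (0 : Euc n) 1).indicator (fun y => (‖y‖ ^ (n - 1))⁻¹) (y - x) :=
    Set.indicator_nonneg (fun z _ => by positivity) _
  have i3 : 0 ≤ (1 + ‖y‖) ^ (-((b + (n - 1) : ℕ) : ℝ)) := Real.rpow_nonneg (by positivity) _
  have tri : 1 ≤ ‖y‖ + ‖y - x‖ := by
    rw [← hx]
    have := norm_sub_le y (y - x)
    simpa using this
  have tri2 : ‖y‖ ≤ 1 + ‖y - x‖ := by
    rw [← hx]
    have := norm_add_le x (y - x)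
    simpa using this
  unfold potK
  by_cases h1 : ‖y‖ < 1 / 2
  · have hm : y ∈ ball (0 : Euc n) 1 := by simp; linarith
    rw [Set.indicator_of_mem hm] at i1 ⊢
    have h2 : (‖y - x‖ ^ (n - 1))⁻¹ ≤ 2 ^ (n - 1) := by
      rw [← inv_pow]
      gcongr
      rw [inv_le_comm₀ (by linarith) (by norm_num)]; linarith
    have h3 := mul_le_mul_of_nonneg_left h2 i1
    have h4 : 0 ≤ (2 : ℝ) ^ b := by positivity
    have h5 : 0 ≤ (3 : ℝ) ^ b * 5 ^ (n - 1) := by positivity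
    have h6 := mul_nonneg h4 i2
    have h7 := mul_nonneg h5 i3
    linarith
  by_cases h2 : ‖y - x‖ < 1 / 2
  · have hm : y - x ∈ ball (0 : Euc n) 1 := by rw [mem_ball_zero_iff]; linarith
    rw [Set.indicator_of_mem hm] at i2 ⊢
    have h3 : (‖y‖ ^ b)⁻¹ ≤ 2 ^ b := by
      rw [← inv_pow]
      gcongr
      rw [inv_le_comm₀ (by linarith) (by norm_num)]; linarith
    have h4 := mul_le_mul_of_nonneg_right h3 i2
    have h5 : 0 ≤ (2 : ℝ) ^ (n - 1) := by positivity
    have h6 := mul_nonneg h5 i1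
    have h7 : 0 ≤ (3 : ℝ) ^ b * 5 ^ (n - 1) := by positivity
    have h8 := mul_nonneg h7 i3
    linarith
  push Not at h1 h2
  have hy : 0 < 1 + ‖y‖ := by positivity
  have e : (1 + ‖y‖) ^ (-((b + (n - 1) : ℕ) : ℝ)) = ((1 + ‖y‖)⁻¹) ^ b * ((1 + ‖y‖)⁻¹) ^ (n - 1) := by
    rw [Real.rpow_neg hy.le, Real.rpow_natCast, ← pow_add, inv_pow]
  have h3 : (‖y‖ ^ b)⁻¹ ≤ 3 ^ b * ((1 + ‖y‖)⁻¹) ^ b := by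
    rw [← inv_pow, ← mul_pow]
    gcongr
    rw [← div_eq_mul_inv, inv_eq_one_div, div_le_div_iff₀ (by linarith) hy]; linarith
  have h4 : (‖y - x‖ ^ (n - 1))⁻¹ ≤ 5 ^ (n - 1) * ((1 + ‖y‖)⁻¹) ^ (n - 1) := by
    rw [← inv_pow, ← mul_pow]
    gcongr
    rw [← div_eq_mul_inv, inv_eq_one_div, div_le_div_iff₀ (by linarith) hy]; linarith
  have h5 := mul_le_mul h3 h4 (by positivity) (by positivity)
  have h6 : 0 ≤ (2 : ℝ) ^ (n - 1) := by positivity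
  have h7 : 0 ≤ (2 : ℝ) ^ b := by positivity
  have h8 := mul_nonneg h6 i1
  have h9 := mul_nonneg h7 i2
  rw [e]
  calc _ ≤ 3 ^ b * (1 + ‖y‖)⁻¹ ^ b * (5 ^ (n - 1) * (1 + ‖y‖)⁻¹ ^ (n - 1)) := h5
    _ = 3 ^ b * 5 ^ (n - 1) * ((1 + ‖y‖)⁻¹ ^ b * (1 + ‖y‖)⁻¹ ^ (n - 1)) := by ring
    _ ≤ _ := by linarith

lemma potK_smul (b : ℕ) {t : ℝ} (ht : 0 < t) (x y : Euc n) :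
    potK n b (t • x) (t • y) = (t ^ (b + (n - 1)))⁻¹ * potK n b x y := by
  unfold potK
  rw [← smul_sub, norm_smul, norm_smul, Real.norm_of_nonneg ht.le, mul_pow, mul_pow, pow_add,
    mul_inv, mul_inv, mul_inv]
  ring

lemma exists_potK_bound (hn : 2 ≤ n) {b : ℕ} (hb2 : 2 ≤ b) (hbn : b ≤ n - 1) :
    ∃ C : ℝ, 0 < C ∧ ∀ x : Euc n, x ≠ 0 →
      Integrable (potK n b x) ∧ ∫ y, potK n b x y ≤ C / ‖x‖ ^ (b - 1) := by
  have j1 := integrable_indicator_norm_inv (n := n) (b := b) (by omega) hbn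
  have j2 := integrable_indicator_norm_inv (n := n) (b := n - 1) (by omega) le_rfl
  have j3 : Integrable (fun y : Euc n => (1 + ‖y‖) ^ (-((b + (n - 1) : ℕ) : ℝ))) := by
    apply integrable_one_add_norm
    rw [finrank_euclideanSpace_fin]
    exact_mod_cast (by omega)
  have J : ∀ x : Euc n, Integrable fun y : Euc n =>
      2 ^ (n - 1) * (ball (0 : Euc n) 1).indicator (fun y => (‖y‖ ^ b)⁻¹) y
      + 2 ^ b * (ball (0 : Euc n) 1).indicator (fun y => (‖y‖ ^ (n - 1))⁻¹) (y - x)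
      + 3 ^ b * 5 ^ (n - 1) * (1 + ‖y‖) ^ (-((b + (n - 1) : ℕ) : ℝ)) := fun x =>
    ((j1.const_mul _).add ((j2.comp_sub_right x).const_mul _)).add (j3.const_mul _)
  set C : ℝ := 2 ^ (n - 1) * (∫ y, (ball (0 : Euc n) 1).indicator (fun y => (‖y‖ ^ b)⁻¹) y)
      + 2 ^ b * (∫ y, (ball (0 : Euc n) 1).indicator (fun y => (‖y‖ ^ (n - 1))⁻¹) y)
      + 3 ^ b * 5 ^ (n - 1) * ∫ y : Euc n, (1 + ‖y‖) ^ (-((b + (n - 1) : ℕ) : ℝ)) with hC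
  have hunit : ∀ x : Euc n, ‖x‖ = 1 → Integrable (potK n b x) ∧ ∫ y, potK n b x y ≤ C := by
    intro x hx
    have hi : Integrable (potK n b x) := by
      refine (J x).mono' (measurable_potK b x).aestronglyMeasurable
        (Eventually.of_forall fun y => ?_)
      rw [Real.norm_of_nonneg (potK_nonneg b x y)]
      exact potK_unit_bound hx y
    refine ⟨hi, (integral_mono hi (J x) (potK_unit_bound hx)).trans_eq ?_⟩
    have k1 := j1.const_mul (2 ^ (n - 1))
    have k2 := (j2.comp_sub_right x).const_mul (2 ^ b)
    have k3 := j3.const_mul (3 ^ b * 5 ^ (n - 1))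
    rw [integral_add (by exact k1.add k2) k3, integral_add k1 k2,
      integral_const_mul, integral_const_mul, integral_const_mul,
      integral_sub_right_eq_self
        (fun y => (ball (0 : Euc n) 1).indicator (fun y => (‖y‖ ^ (n - 1))⁻¹) y)]
  have hC0 : 0 ≤ C := by
    rw [hC]
    have a1 : 0 ≤ ∫ y, (ball (0 : Euc n) 1).indicator (fun y => (‖y‖ ^ b)⁻¹) y :=
      integral_nonneg fun y => Set.indicator_nonneg (fun z _ => by positivity) _
    have a2 : 0 ≤ ∫ y, (ball (0 : Euc n) 1).indicator (fun y => (‖y‖ ^ (n - 1))⁻¹) y :=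
      integral_nonneg fun y => Set.indicator_nonneg (fun z _ => by positivity) _
    have a3 : 0 ≤ ∫ y : Euc n, (1 + ‖y‖) ^ (-((b + (n - 1) : ℕ) : ℝ)) :=
      integral_nonneg fun y => Real.rpow_nonneg (by positivity) _
    positivity
  refine ⟨C + 1, by linarith, fun x hx => ?_⟩
  have ht : 0 < ‖x‖ := norm_pos_iff.2 hx
  set t := ‖x‖ with htdef
  obtain ⟨hi, hint⟩ := hunit (t⁻¹ • x) (by
    rw [norm_smul, norm_inv, norm_norm, ← htdef, inv_mul_cancel₀ ht.ne'])
  have e : ∀ y, potK n b x (t • y) = (t ^ (b + (n - 1)))⁻¹ * potK n b (t⁻¹ • x) y := by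
    intro y
    rw [← potK_smul b ht, smul_inv_smul₀ ht.ne']
  constructor
  · rw [← integrable_comp_smul_iff volume (potK n b x) ht.ne']
    simp only [e]
    exact hi.const_mul _
  · have h := Measure.integral_comp_smul (volume : Measure (Euc n)) (potK n b x) t
    simp only [e, integral_const_mul] at h
    rw [finrank_euclideanSpace_fin, smul_eq_mul, abs_of_pos (by positivity)] at h
    have h2 : ∫ y, potK n b x y = (∫ y, potK n b (t⁻¹ • x) y) / t ^ (b - 1) := by
      have e3 : t ^ (b + (n - 1)) = t ^ (b - 1) * t ^ n := by
        rw [← pow_add]; congr 1; omega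
      rw [e3] at h
      field_simp at h ⊢
      linarith
    rw [h2]
    gcongr
    linarith

end Potential

section Cutoff

/-- A bump function centred at the origin, with radii `3 / 2` and `2`. -/
noncomputable def cutBump (n : ℕ) : ContDiffBump (0 : Euc n) :=
  ⟨3 / 2, 2, by norm_num, by norm_num⟩

/-- A smooth cutoff: one on the ball of radius `3 / 2`, zero outside the ball of radius `2`. -/
noncomputable def cut : Euc n → ℝ := fun y => cutBump n y

/-- The cutoff at scale `L`. -/
noncomputable def cutAt (L : ℝ) : Euc n → ℝ := fun y => cut (L⁻¹ • y)

variable {y : Euc n} {L : ℝ}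

lemma contDiff_cut : ContDiff ℝ ∞ (cut : Euc n → ℝ) := (cutBump n).contDiff

lemma contDiff_cutAt (L : ℝ) : ContDiff ℝ ∞ (cutAt L : Euc n → ℝ) :=
  contDiff_cut.comp (contDiff_const_smul _)

lemma cut_nonneg (y : Euc n) : 0 ≤ cut y := (cutBump n).nonneg' y

lemma cut_le_one (y : Euc n) : cut y ≤ 1 := (cutBump n).le_one

lemma cut_eq_one (hy : ‖y‖ ≤ 3 / 2) : cut y = 1 :=
  (cutBump n).one_of_mem_closedBall (by simpa [cutBump] using hy)

lemma cut_eq_zero (hy : 2 ≤ ‖y‖) : cut y = 0 :=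
  (cutBump n).zero_of_le_dist (by simpa [cutBump] using hy)

lemma norm_inv_smul (hL : 0 < L) (y : Euc n) : ‖L⁻¹ • y‖ = ‖y‖ / L := by
  rw [norm_smul, norm_inv, Real.norm_of_nonneg hL.le]; ring

lemma cutAt_eq_one (hL : 0 < L) (hy : ‖y‖ ≤ 3 / 2 * L) : cutAt L y = 1 :=
  cut_eq_one (by rwa [norm_inv_smul hL, div_le_iff₀ hL])

lemma cutAt_eq_zero (hL : 0 < L) (hy : 2 * L ≤ ‖y‖) : cutAt L y = 0 :=
  cut_eq_zero (by rwa [norm_inv_smul hL, le_div_iff₀ hL])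

lemma abs_cutAt_sub_cut_le (L : ℝ) (y : Euc n) : |cutAt L y - cut y| ≤ 1 := by
  rw [abs_le]
  constructor <;> linarith [cut_nonneg y, cut_le_one y, cut_nonneg (L⁻¹ • y),
    cut_le_one (L⁻¹ • y), show cutAt L y = cut (L⁻¹ • y) from rfl]

lemma exists_dn_cut_le (n : ℕ) : ∃ Z : ℝ, 1 ≤ Z ∧ ∀ k ≤ 3, ∀ y : Euc n, dn k cut y ≤ Z := by
  have h : ∀ k : ℕ, ∃ Z : ℝ, ∀ y : Euc n, dn k cut y ≤ Z := by
    intro k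
    have hc : HasCompactSupport (iteratedFDeriv ℝ k (cut : Euc n → ℝ)) :=
      (cutBump n).hasCompactSupport.iteratedFDeriv k
    obtain ⟨Z, hZ⟩ := hc.exists_bound_of_continuous
      (contDiff_cut.continuous_iteratedFDeriv (m := k) (mod_cast le_top))
    exact ⟨Z, hZ⟩
  choose Z hZ using h
  refine ⟨1 + ∑ k ∈ Finset.range 4, |Z k|, ?_, fun k hk y => ?_⟩
  · linarith [Finset.sum_nonneg fun k (_ : k ∈ Finset.range 4) => abs_nonneg (Z k)]
  · have := Finset.single_le_sum (f := fun k => |Z k|) (fun k _ => abs_nonneg _)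
      (show k ∈ Finset.range 4 by simp; omega)
    linarith [hZ k y, le_abs_self (Z k)]

lemma dn_cutAt (hL : 0 < L) (k : ℕ) (y : Euc n) :
    dn k (cutAt L) y = dn k cut (L⁻¹ • y) / L ^ k := by
  have h := iteratedFDeriv_comp_const_smul (𝕜 := ℝ) (i := k) (L⁻¹)
    ((contDiff_cut (n := n)).of_le (mod_cast le_top))
  have h2 : iteratedFDeriv ℝ k (cutAt L) y = (L⁻¹) ^ k • iteratedFDeriv ℝ k cut (L⁻¹ • y) :=
    congrFun h y
  simp only [dn, h2, norm_smul, norm_pow, norm_inv, Real.norm_of_nonneg hL.le]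
  rw [inv_pow]; ring

lemma symb_cutAt {Z : ℝ} (hZ : ∀ k ≤ 3, ∀ y : Euc n, dn k cut y ≤ Z) (hL : 0 < L) {x y : Euc n}
    (hx : ‖x‖ ≤ L) (hyx : y ≠ x) : Symb (cutAt L) (27 * Z) ‖y - x‖ y := by
  have hr : 0 < ‖y - x‖ := norm_pos_iff.2 (sub_ne_zero.2 hyx)
  have hZ0 : 0 ≤ Z := (dn_nonneg 0 cut 0).trans (hZ 0 (by simp) 0)
  intro k hk
  by_cases hy : ‖y‖ ≤ 2 * L
  · rw [dn_cutAt hL]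
    have h3 : ‖y - x‖ ≤ 3 * L := (norm_sub_le _ _).trans (by linarith)
    rw [div_le_div_iff₀ (by positivity) (by positivity)]
    have h27 : (3 : ℝ) ^ k ≤ 27 := (pow_le_pow_right₀ (by norm_num) hk).trans (by norm_num)
    calc dn k cut (L⁻¹ • y) * ‖y - x‖ ^ k ≤ Z * (3 * L) ^ k := by
          gcongr
          exact hZ k hk _
      _ = 3 ^ k * (Z * L ^ k) := by rw [mul_pow]; ring
      _ ≤ 27 * (Z * L ^ k) := by gcongr
      _ = _ := by ring
  · push Not at hy
    have h : (cutAt L : Euc n → ℝ) =ᶠ[𝓝 y] fun _ => 0 := by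
      filter_upwards [(isOpen_norm_gt (2 * L)).mem_nhds hy] with z hz
      exact cutAt_eq_zero hL (le_of_lt hz)
    rw [dn_congr h]
    have := Symb.const 0 hr y k hk
    rw [abs_zero, zero_div] at this
    exact this.trans (by positivity)

end Cutoff

section TestField

/-- The divergence of the antisymmetric matrix `W i * δ j k - W j * δ i k`. -/
noncomputable def testField (W : Fin n → Euc n → ℝ) (k j : Fin n) : Euc n → ℝ :=
  fun y => (if j = k then 1 else 0) * dvg W y - pd k (W j) y

variable {W : Fin n → Euc n → ℝ} {y : Euc n} {i j k : Fin n}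

lemma contDiff_testField (hW : ∀ i, ContDiff ℝ ∞ (W i)) (k j : Fin n) :
    ContDiff ℝ ∞ (testField W k j) :=
  (contDiff_const.mul (contDiff_dvg hW)).sub (contDiff_pd (hW j) k)

lemma pd_dvg (hW : ∀ i, ContDiff ℝ ∞ (W i)) (i : Fin n) :
    pd i (dvg W) = dvg fun l => pd i (W l) := by
  unfold dvg
  rw [pd_sum fun l => contDiff_pd (hW l) l]
  funext y
  exact Finset.sum_congr rfl fun l _ => by rw [pd_comm (hW l)]

lemma lap_pd {f : Euc n → ℝ} (hf : ContDiff ℝ ∞ f) (i : Fin n) :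
    lap (pd i f) = pd i (lap f) := by
  unfold lap
  rw [pd_sum fun l => contDiff_pd (contDiff_pd hf l) l]
  funext y
  exact Finset.sum_congr rfl fun l _ => by
    rw [pd_comm (i := l) (j := i) hf, pd_comm (i := l) (j := i) (contDiff_pd hf l)]

lemma dvg_testField (hW : ∀ i, ContDiff ℝ ∞ (W i)) (k : Fin n) (y : Euc n) :
    dvg (testField W k) y = 0 := by
  have h : ∀ j, pd j (testField W k j) y
      = (if j = k then 1 else 0) * pd j (dvg W) y - pd j (pd k (W j)) y := by
    intro j
    unfold testField
    rw [pd_sub (contDiff_const.mul (contDiff_dvg hW)) (contDiff_pd (hW j) k),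
      pd_const_mul _ (contDiff_dvg hW)]
  simp only [dvg] at *
  simp only [h, Finset.sum_sub_distrib, ite_mul, one_mul, zero_mul, Finset.sum_ite_eq',
    Finset.mem_univ, if_true]
  rw [sub_eq_zero]
  have := congrFun (pd_dvg hW k) y
  exact this

lemma testField_congr {Z : Fin n → Euc n → ℝ} (h : ∀ i, W i =ᶠ[𝓝 y] Z i) (k j : Fin n) :
    testField W k j =ᶠ[𝓝 y] testField Z k j := by
  filter_upwards [dvg_congr h, pd_congr (i := k) (h j)] with z h1 h2
  simp only [testField, h1, h2]

lemma testField_const (c : Fin n → ℝ) (k j : Fin n) :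
    testField (fun i (_ : Euc n) => c i) k j = fun _ => 0 := by
  funext y
  simp [testField, dvg, pd_const]

lemma pd_testField (hW : ∀ i, ContDiff ℝ ∞ (W i)) (i k j : Fin n) :
    pd i (testField W k j) = testField (fun l => pd i (W l)) k j := by
  unfold testField
  rw [pd_sub (contDiff_const.mul (contDiff_dvg hW)) (contDiff_pd (hW j) k),
    pd_const_mul _ (contDiff_dvg hW), pd_dvg hW, pd_comm (hW j)]

lemma abs_testField_le (hW : ∀ i, ContDiff ℝ ∞ (W i)) {M : ℝ} (h : ∀ l, dn 1 (W l) y ≤ M) :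
    |testField W k j y| ≤ (n + 1) * M := by
  have hM : 0 ≤ M := (dn_nonneg 1 _ y).trans (h k)
  have h1 : |dvg W y| ≤ n * M := by
    refine (Finset.abs_sum_le_sum_abs _ _).trans ?_
    refine (Finset.sum_le_sum fun l _ => (abs_pd_le (hW l)).trans (h l)).trans_eq ?_
    simp
  have h2 : |pd k (W j) y| ≤ M := (abs_pd_le (hW j)).trans (h j)
  have h3 : |(if j = k then (1 : ℝ) else 0) * dvg W y| ≤ n * M := by
    split_ifs
    · rwa [one_mul]
    · simp; positivity
  exact (abs_sub _ _).trans (by linarith)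

lemma abs_pd_testField_le (hW : ∀ i, ContDiff ℝ ∞ (W i)) {M : ℝ} (h : ∀ l, dn 2 (W l) y ≤ M) :
    |pd i (testField W k j) y| ≤ (n + 1) * M := by
  rw [pd_testField hW]
  exact abs_testField_le (fun l => contDiff_pd (hW l) i) fun l => (dn_pd_le (hW l) 1).trans (h l)

lemma abs_lap_testField_le (hW : ∀ i, ContDiff ℝ ∞ (W i)) {M : ℝ}
    (h : ∀ l, dn 3 (W l) y ≤ M) : |lap (testField W k j) y| ≤ n * ((n + 1) * M) := by
  refine (Finset.abs_sum_le_sum_abs _ _).trans ?_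
  refine (Finset.sum_le_sum (g := fun _ => (n + 1) * M) fun l _ => ?_).trans_eq (by simp)
  rw [pd_testField hW]
  exact abs_pd_testField_le (fun l' => contDiff_pd (hW l') l) fun l' =>
    (dn_pd_le (hW l') 2).trans (h l')

/-- The error by which a test field fails to solve the dual Stokes problem exactly. -/
noncomputable def dualErr (W V : Fin n → Euc n → ℝ) (η : Euc n → ℝ) (k j : Fin n) : Euc n → ℝ :=
  fun y => lap (testField W k j) y + pd j (fun z => η z * lap (V k) z) y
    - (if j = k then 1 else 0) * (η y * lap (dvg V) y)

lemma dualErr_eq_zero {V : Fin n → Euc n → ℝ} {η : Euc n → ℝ} (hV : ∀ i, ContDiff ℝ ∞ (V i))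
    (hsymm : ∀ i j, pd i (V j) = pd j (V i)) (hW : ∀ i, W i =ᶠ[𝓝 y] V i)
    (hη : η =ᶠ[𝓝 y] fun _ => 1) : dualErr W V η k j y = 0 := by
  have h1 : lap (testField W k j) y = lap (testField V k j) y :=
    (lap_congr (testField_congr hW k j)).eq_of_nhds
  have h2 : (fun z => η z * lap (V k) z) =ᶠ[𝓝 y] lap (V k) := by
    filter_upwards [hη] with z hz
    rw [hz, one_mul]
  have h3 : lap (testField V k j) y
      = (if j = k then 1 else 0) * lap (dvg V) y - pd j (lap (V k)) y := by
    unfold testField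
    rw [lap_sub (contDiff_const.mul (contDiff_dvg hV)) (contDiff_pd (hV j) k),
      lap_const_mul _ (contDiff_dvg hV), hsymm k j, lap_pd (hV k)]
  rw [dualErr, h1, (pd_congr h2).eq_of_nhds, h3, hη.eq_of_nhds]
  ring

lemma abs_dualErr_le {V : Fin n → Euc n → ℝ} {η : Euc n → ℝ} (hV : ∀ i, ContDiff ℝ ∞ (V i))
    (hW : ∀ i, ContDiff ℝ ∞ (W i)) (hη : ContDiff ℝ ∞ η) {M : ℝ} (hη1 : |η y| ≤ 1)
    (h1 : ∀ l, dn 3 (W l) y ≤ M) (h2 : ∀ l, dn 3 (V l) y ≤ M)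
    (h3 : ∀ l, dn 1 η y * dn 2 (V l) y ≤ M) :
    |dualErr W V η k j y| ≤ 5 * n ^ 2 * M := by
  have hM : 0 ≤ M := (dn_nonneg 3 _ y).trans (h1 k)
  have hn1 : (1 : ℝ) ≤ n := by exact_mod_cast (Fin.pos k)
  have e1 := abs_lap_testField_le (k := k) (j := j) hW h1
  have e2 : |pd j (fun z => η z * lap (V k) z) y| ≤ n * M + n * M := by
    rw [pd_mul hη (contDiff_lap (hV k))]
    refine (abs_add_le _ _).trans (add_le_add ?_ ?_)
    · rw [abs_mul]
      have : |lap (V k) y| ≤ n * dn 2 (V k) y :=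
        (Finset.abs_sum_le_sum_abs _ _).trans
          ((Finset.sum_le_sum fun l _ => abs_pd_pd_le (hV k)).trans_eq (by simp))
      calc |pd j η y| * |lap (V k) y| ≤ dn 1 η y * (n * dn 2 (V k) y) := by
            gcongr
            · exact dn_nonneg _ _ _
            · exact abs_pd_le hη
        _ = n * (dn 1 η y * dn 2 (V k) y) := by ring
        _ ≤ n * M := by gcongr; exact h3 k
    · rw [abs_mul]
      have : |pd j (lap (V k)) y| ≤ n * M := by
        rw [← lap_pd (hV k)]
        exact (Finset.abs_sum_le_sum_abs _ _).trans
          ((Finset.sum_le_sum fun l _ => (abs_pd_pd_pd_le (hV k) l l j).trans (h2 k)).trans_eq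
            (by simp))
      calc |η y| * |pd j (lap (V k)) y| ≤ 1 * (n * M) := by gcongr
        _ = n * M := one_mul _
  have e3 : |lap (dvg V) y| ≤ n * (n * M) := by
    refine (Finset.abs_sum_le_sum_abs _ _).trans ?_
    refine (Finset.sum_le_sum (g := fun _ => n * M) fun l _ => ?_).trans_eq (by simp)
    rw [pd_dvg hV, pd_dvg fun l' => contDiff_pd (hV l') l]
    refine (Finset.abs_sum_le_sum_abs _ _).trans ?_
    refine (Finset.sum_le_sum (g := fun _ => M) fun l' _ => ?_).trans_eq (by simp)
    exact (abs_pd_le (contDiff_pd (contDiff_pd (hV l') l) l)).trans <|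
      (dn_pd_le (contDiff_pd (hV l') l) 1).trans <| (dn_pd_le (hV l') 2).trans (h2 l')
  have e4 : |(if j = k then (1 : ℝ) else 0) * (η y * lap (dvg V) y)| ≤ n * (n * M) := by
    split_ifs
    · rw [one_mul, abs_mul]
      calc |η y| * |lap (dvg V) y| ≤ 1 * (n * (n * M)) := by gcongr
        _ = _ := one_mul _
    · simp; positivity
  have e5 : |dualErr W V η k j y| ≤ n * ((n + 1) * M) + (n * M + n * M) + n * (n * M) :=
    (abs_sub _ _).trans (add_le_add ((abs_add_le _ _).trans (add_le_add e1 e2)) e4)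
  refine e5.trans ?_
  have : (n : ℝ) * M ≤ n ^ 2 * M := by
    rw [sq]; exact mul_le_mul_of_nonneg_right (by nlinarith) hM
  nlinarith

end TestField

section Localization

/-- The field `V`, truncated at scale `L`, and modified near the origin to be constant there. -/
noncomputable def locField (L : ℝ) (V : Fin n → Euc n → ℝ) (i : Fin n) : Euc n → ℝ :=
  fun y => cutAt L y * V i y - cut y * (V i y - V i 0)

/-- The cutoff to the annulus between the unit scale and the scale `L`. -/
noncomputable def cutAnn (L : ℝ) : Euc n → ℝ := fun y => cutAt L y - cut y

variable {L : ℝ} {V : Fin n → Euc n → ℝ} {x y : Euc n} {A Z : ℝ}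

lemma contDiff_cutAnn (L : ℝ) : ContDiff ℝ ∞ (cutAnn L : Euc n → ℝ) :=
  (contDiff_cutAt L).sub contDiff_cut

lemma contDiff_locField (hV : ∀ i, ContDiff ℝ ∞ (V i)) (i : Fin n) :
    ContDiff ℝ ∞ (locField L V i) :=
  ((contDiff_cutAt L).mul (hV i)).sub (contDiff_cut.mul ((hV i).sub contDiff_const))

lemma locField_eventuallyEq_of_norm_lt (hL : 1 ≤ L) (hy : ‖y‖ < 3 / 2) (i : Fin n) :
    locField L V i =ᶠ[𝓝 y] fun _ => V i 0 := by
  filter_upwards [(isOpen_norm_lt (3 / 2)).mem_nhds hy] with z hz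
  have hz : ‖z‖ < 3 / 2 := hz
  rw [locField, cut_eq_one hz.le, cutAt_eq_one (by linarith) (by linarith)]
  ring

lemma cutAnn_eventuallyEq_of_norm_lt (hL : 1 ≤ L) (hy : ‖y‖ < 3 / 2) :
    cutAnn L =ᶠ[𝓝 y] fun _ => 0 := by
  filter_upwards [(isOpen_norm_lt (3 / 2)).mem_nhds hy] with z hz
  have hz : ‖z‖ < 3 / 2 := hz
  rw [cutAnn, cut_eq_one hz.le, cutAt_eq_one (by linarith) (by linarith)]
  ring

lemma locField_eventuallyEq_of_norm_gt (hL : 1 ≤ L) (hy : 2 * L < ‖y‖) (i : Fin n) :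
    locField L V i =ᶠ[𝓝 y] fun _ => 0 := by
  filter_upwards [(isOpen_norm_gt (2 * L)).mem_nhds hy] with z hz
  have hz : 2 * L < ‖z‖ := hz
  rw [locField, cut_eq_zero (by linarith), cutAt_eq_zero (by linarith) hz.le]
  ring

lemma cutAnn_eventuallyEq_of_norm_gt (hL : 1 ≤ L) (hy : 2 * L < ‖y‖) :
    cutAnn L =ᶠ[𝓝 y] fun _ => 0 := by
  filter_upwards [(isOpen_norm_gt (2 * L)).mem_nhds hy] with z hz
  have hz : 2 * L < ‖z‖ := hz
  rw [cutAnn, cut_eq_zero (by linarith), cutAt_eq_zero (by linarith) hz.le]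
  ring

lemma locField_eventuallyEq_of_two_lt (hy : 2 < ‖y‖) (i : Fin n) :
    locField L V i =ᶠ[𝓝 y] fun z => cutAt L z * V i z := by
  filter_upwards [(isOpen_norm_gt 2).mem_nhds hy] with z hz
  have hz : 2 < ‖z‖ := hz
  rw [locField, cut_eq_zero hz.le]
  ring

lemma cutAnn_eventuallyEq_of_two_lt (hy : 2 < ‖y‖) :
    cutAnn L =ᶠ[𝓝 y] cutAt L := by
  filter_upwards [(isOpen_norm_gt 2).mem_nhds hy] with z hz
  have hz : 2 < ‖z‖ := hz
  rw [cutAnn, cut_eq_zero hz.le]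
  ring

lemma cutAt_eventuallyEq_one (hL : 0 < L) (hy : ‖y‖ < 3 / 2 * L) :
    cutAt L =ᶠ[𝓝 y] fun _ => 1 := by
  filter_upwards [(isOpen_norm_lt (3 / 2 * L)).mem_nhds hy] with z hz
  exact cutAt_eq_one hL (le_of_lt hz)

lemma dualErr_eq_zero_of_const {W : Fin n → Euc n → ℝ} {η : Euc n → ℝ} {c : Fin n → ℝ}
    (hW : ∀ i, W i =ᶠ[𝓝 y] fun _ => c i) (hη : η =ᶠ[𝓝 y] fun _ => 0) (k j : Fin n) :
    dualErr W V η k j y = 0 := by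
  have h1 : testField W k j =ᶠ[𝓝 y] fun _ => 0 := by
    rw [← testField_const c k j]; exact testField_congr hW k j
  have h2 : (fun z => η z * lap (V k) z) =ᶠ[𝓝 y] fun _ => 0 := by
    filter_upwards [hη] with z hz
    rw [hz, zero_mul]
  have h3 : lap (fun _ : Euc n => (0 : ℝ)) y = 0 :=
    lap_eq_zero_of_isOpen isOpen_univ (fun _ _ => rfl) y trivial
  rw [dualErr, (lap_congr h1).eq_of_nhds, (pd_congr h2).eq_of_nhds, hη.eq_of_nhds, h3, pd_const]
  simp

lemma testField_eq_zero_of_const {W : Fin n → Euc n → ℝ} {c : Fin n → ℝ}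
    (hW : ∀ i, W i =ᶠ[𝓝 y] fun _ => c i) (k j : Fin n) : testField W k j =ᶠ[𝓝 y] fun _ => 0 := by
  rw [← testField_const c k j]; exact testField_congr hW k j

lemma pd_testField_eq_zero_of_const {W : Fin n → Euc n → ℝ} {c : Fin n → ℝ}
    (hW : ∀ i, W i =ᶠ[𝓝 y] fun _ => c i) (i k j : Fin n) : pd i (testField W k j) y = 0 := by
  rw [(pd_congr (testField_eq_zero_of_const hW k j)).eq_of_nhds, pd_const]

lemma half_norm_le (hx : 4 ≤ ‖x‖) (hy : ‖y‖ ≤ 2) : ‖x‖ / 2 ≤ ‖y - x‖ := by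
  have := norm_sub_norm_le x y
  rw [norm_sub_rev] at this
  linarith

lemma dn_le_of_symb (hn : 4 ≤ n) (hA : 0 ≤ A)
    (hs : ∀ y, y ≠ x → ∀ i, Symb (V i) (A / ‖y - x‖ ^ (n - 3)) ‖y - x‖ y)
    (hx : 4 ≤ ‖x‖) (hy : ‖y‖ ≤ 2) (i : Fin n) {k : ℕ} (hk1 : 1 ≤ k) (hk : k ≤ 3) :
    dn k (V i) y ≤ 2 ^ (n - 2) * A / ‖x‖ ^ (n - 2) := by
  have hr := half_norm_le hx hy
  have hyx : y ≠ x := by rintro rfl; linarith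
  refine (hs y hyx i k hk).trans ?_
  have h1 : (‖x‖ / 2) ^ (n - 2) ≤ ‖y - x‖ ^ (n - 3) * ‖y - x‖ ^ k := by
    rw [← pow_add]
    calc (‖x‖ / 2) ^ (n - 2) ≤ ‖y - x‖ ^ (n - 2) := by gcongr
      _ ≤ _ := pow_le_pow_right₀ (by linarith) (by omega)
  have h2 : 2 ^ (n - 2) * A / ‖x‖ ^ (n - 2) = A / (‖x‖ / 2) ^ (n - 2) := by
    rw [div_pow, div_div_eq_mul_div, mul_comm]
  rw [div_div, h2]
  have : 0 < ‖x‖ := by linarith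
  gcongr

lemma dn_one_eq (f : Euc n → ℝ) : dn 1 f y = ‖fderiv ℝ f y‖ := by
  rw [dn, ← norm_iteratedFDeriv_fderiv]
  simp

lemma symb_sub_const (hn : 4 ≤ n) (hA : 0 ≤ A) (hV : ∀ i, ContDiff ℝ ∞ (V i))
    (hs : ∀ y, y ≠ x → ∀ i, Symb (V i) (A / ‖y - x‖ ^ (n - 3)) ‖y - x‖ y)
    (hx : 4 ≤ ‖x‖) (hy : ‖y‖ ≤ 2) (i : Fin n) :
    Symb (fun z => V i z - V i 0) (2 * (2 ^ (n - 2) * A / ‖x‖ ^ (n - 2))) 1 y := by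
  set M := 2 ^ (n - 2) * A / ‖x‖ ^ (n - 2) with hM
  have hM0 : 0 ≤ M := by positivity
  intro k hk
  rw [one_pow, div_one]
  rcases Nat.eq_zero_or_pos k with rfl | hk0
  · rw [dn_zero]
    have h := (convex_closedBall (0 : Euc n) 2).norm_image_sub_le_of_norm_fderiv_le
      (f := V i) (𝕜 := ℝ) (C := M) (fun z _ => differentiable_of_smooth (hV i) z)
      (fun z hz => by
        rw [← dn_one_eq]
        exact dn_le_of_symb hn hA hs hx (by simpa using hz) i le_rfl (by norm_num))
      (x := 0) (y := y) (by simp) (by simpa using hy)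
    rw [Real.norm_eq_abs, sub_zero] at h
    nlinarith
  · have h := dn_sub_le (y := y) (hV i) (contDiff_const (c := V i 0)) k
    have h0 : dn k (fun _ : Euc n => V i 0) y = 0 := by
      obtain ⟨m, rfl⟩ := Nat.exists_eq_succ_of_ne_zero hk0.ne'
      simp [dn, iteratedFDeriv_succ_const]
    have := dn_le_of_symb hn hA hs hx hy i hk0 hk
    linarith

lemma dn_locField_near (hn : 4 ≤ n) (hA : 0 ≤ A)
    (hZ : ∀ k ≤ 3, ∀ y : Euc n, dn k cut y ≤ Z) (hV : ∀ i, ContDiff ℝ ∞ (V i))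
    (hs : ∀ y, y ≠ x → ∀ i, Symb (V i) (A / ‖y - x‖ ^ (n - 3)) ‖y - x‖ y)
    (hx : 4 ≤ ‖x‖) (hL : 2 * ‖x‖ ≤ L) (hy : ‖y‖ ≤ 2) (i : Fin n) {k : ℕ} (hk1 : 1 ≤ k)
    (hk : k ≤ 3) :
    dn k (locField L V i) y ≤ (1 + 16 * Z) * (2 ^ (n - 2) * A / ‖x‖ ^ (n - 2)) := by
  have hc : Symb cut Z 1 y := fun k hk => by simpa using hZ k hk y
  have hm := Symb.mul one_pos contDiff_cut ((hV i).sub contDiff_const) hc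
    (symb_sub_const hn hA hV hs hx hy i) k hk
  have he : locField L V i =ᶠ[𝓝 y] fun z => V i z - cut z * (V i z - V i 0) := by
    filter_upwards [cutAt_eventuallyEq_one (y := y) (by linarith : 0 < L) (by linarith)] with z hz
    rw [locField, hz, one_mul]
  rw [dn_congr he]
  refine (dn_sub_le (hV i) (contDiff_cut.mul ((hV i).sub contDiff_const)) k).trans ?_
  have := dn_le_of_symb hn hA hs hx hy i hk1 hk
  rw [one_pow, div_one] at hm
  refine (add_le_add this hm).trans (le_of_eq ?_)
  ring

lemma abs_pd_testField_near (hn : 4 ≤ n) (hA : 0 ≤ A)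
    (hZ : ∀ k ≤ 3, ∀ y : Euc n, dn k cut y ≤ Z) (hV : ∀ i, ContDiff ℝ ∞ (V i))
    (hs : ∀ y, y ≠ x → ∀ i, Symb (V i) (A / ‖y - x‖ ^ (n - 3)) ‖y - x‖ y)
    (hx : 4 ≤ ‖x‖) (hL : 2 * ‖x‖ ≤ L) (hy : ‖y‖ ≤ 2) (i k j : Fin n) :
    |pd i (testField (locField L V) k j) y|
      ≤ (n + 1) * ((1 + 16 * Z) * (2 ^ (n - 2) * A / ‖x‖ ^ (n - 2))) :=
  abs_pd_testField_le (contDiff_locField hV) fun l =>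
    dn_locField_near hn hA hZ hV hs hx hL hy l (by norm_num) (by norm_num)

lemma abs_dualErr_near (hn : 4 ≤ n) (hA : 0 ≤ A) (hZ1 : 1 ≤ Z)
    (hZ : ∀ k ≤ 3, ∀ y : Euc n, dn k cut y ≤ Z) (hV : ∀ i, ContDiff ℝ ∞ (V i))
    (hs : ∀ y, y ≠ x → ∀ i, Symb (V i) (A / ‖y - x‖ ^ (n - 3)) ‖y - x‖ y)
    (hx : 4 ≤ ‖x‖) (hL : 2 * ‖x‖ ≤ L) (hy : ‖y‖ ≤ 2) (k j : Fin n) :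
    |dualErr (locField L V) V (cutAnn L) k j y|
      ≤ 5 * n ^ 2 * ((1 + 16 * Z) * (2 ^ (n - 2) * A / ‖x‖ ^ (n - 2))) := by
  set M := 2 ^ (n - 2) * A / ‖x‖ ^ (n - 2) with hM
  have hM0 : 0 ≤ M := by positivity
  refine abs_dualErr_le hV (contDiff_locField hV) (contDiff_cutAnn L)
    (abs_cutAt_sub_cut_le L y)
    (fun l => dn_locField_near hn hA hZ hV hs hx hL hy l (by norm_num) le_rfl)
    (fun l => (dn_le_of_symb hn hA hs hx hy l (by norm_num) le_rfl).trans ?_) fun l => ?_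
  · nlinarith
  · have h1 : dn 1 (cutAnn L) y ≤ 2 * Z := by
      refine (dn_sub_le (contDiff_cutAt L) contDiff_cut 1).trans ?_
      have h2 := hZ 1 (by norm_num) y
      have h3 : dn 1 (cutAt L) y ≤ Z := by
        rw [dn_cutAt (by linarith), pow_one]
        exact (div_le_self (dn_nonneg _ _ _) (by linarith)).trans (hZ 1 (by norm_num) _)
      linarith
    calc dn 1 (cutAnn L) y * dn 2 (V l) y ≤ 2 * Z * M := by
          gcongr
          · exact dn_nonneg _ _ _
          · exact dn_le_of_symb hn hA hs hx hy l (by norm_num) (by norm_num)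
      _ ≤ (1 + 16 * Z) * M := by nlinarith

lemma symb_locField_far (hZ : ∀ k ≤ 3, ∀ y : Euc n, dn k cut y ≤ Z)
    (hV : ∀ i, ContDiff ℝ ∞ (V i))
    (hs : ∀ y, y ≠ x → ∀ i, Symb (V i) (A / ‖y - x‖ ^ (n - 3)) ‖y - x‖ y)
    (hL : 0 < L) (hxL : ‖x‖ ≤ L) (hyx : y ≠ x) (hy : 2 < ‖y‖) (i : Fin n) :
    Symb (locField L V i) (8 * (27 * Z) * (A / ‖y - x‖ ^ (n - 3))) ‖y - x‖ y := by
  have hr : 0 < ‖y - x‖ := norm_pos_iff.2 (sub_ne_zero.2 hyx)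
  intro k hk
  rw [dn_congr (locField_eventuallyEq_of_two_lt hy i)]
  exact Symb.mul hr (contDiff_cutAt L) (hV i) (symb_cutAt hZ hL hxL hyx) (hs y hyx i) k hk

lemma abs_pd_testField_far (hn : 4 ≤ n) (hZ : ∀ k ≤ 3, ∀ y : Euc n, dn k cut y ≤ Z)
    (hV : ∀ i, ContDiff ℝ ∞ (V i))
    (hs : ∀ y, y ≠ x → ∀ i, Symb (V i) (A / ‖y - x‖ ^ (n - 3)) ‖y - x‖ y)
    (hL : 0 < L) (hxL : ‖x‖ ≤ L) (hyx : y ≠ x) (hy : 2 < ‖y‖) (i k j : Fin n) :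
    |pd i (testField (locField L V) k j) y| ≤ (n + 1) * (216 * Z * A / ‖y - x‖ ^ (n - 1)) := by
  refine abs_pd_testField_le (contDiff_locField hV) fun l =>
    (symb_locField_far hZ hV hs hL hxL hyx hy l 2 (by norm_num)).trans_eq ?_
  rw [show n - 1 = n - 3 + 2 by omega, pow_add]
  ring

lemma abs_dualErr_far (hn : 4 ≤ n) (hA : 0 ≤ A) (hZ1 : 1 ≤ Z)
    (hZ : ∀ k ≤ 3, ∀ y : Euc n, dn k cut y ≤ Z) (hV : ∀ i, ContDiff ℝ ∞ (V i))
    (hs : ∀ y, y ≠ x → ∀ i, Symb (V i) (A / ‖y - x‖ ^ (n - 3)) ‖y - x‖ y)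
    (hx : 4 ≤ ‖x‖) (hL : 2 * ‖x‖ ≤ L) (hy : 3 / 2 * L ≤ ‖y‖) (k j : Fin n) :
    |dualErr (locField L V) V (cutAnn L) k j y| ≤ 5 * n ^ 2 * (216 * Z * A / L ^ n) := by
  have hr : L ≤ ‖y - x‖ := by linarith [norm_sub_norm_le y x]
  have hL0 : 0 < L := by linarith
  have hr0 : 0 < ‖y - x‖ := by linarith
  have hyx : y ≠ x := by rintro rfl; simp at hr0
  have hy2 : 2 < ‖y‖ := by linarith
  have e : ‖y - x‖ ^ n = ‖y - x‖ ^ (n - 3) * ‖y - x‖ ^ 3 := by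
    rw [← pow_add]; congr 1; omega
  have hle : 216 * Z * A / ‖y - x‖ ^ n ≤ 216 * Z * A / L ^ n := by gcongr
  refine abs_dualErr_le hV (contDiff_locField hV) (contDiff_cutAnn L)
    (abs_cutAt_sub_cut_le L y) (fun l => ?_) (fun l => ?_) fun l => ?_
  · refine ((symb_locField_far hZ hV hs hL0 (by linarith) hyx hy2 l 3 le_rfl).trans_eq ?_).trans hle
    rw [e]; ring
  · refine ((hs y hyx l 3 le_rfl).trans ?_).trans hle
    rw [e, div_div]
    gcongr
    nlinarith
  · rw [dn_congr (cutAnn_eventuallyEq_of_two_lt hy2)]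
    have h1 := symb_cutAt hZ hL0 (by linarith) hyx 1 (by norm_num)
    have h2 := hs y hyx l 2 (by norm_num)
    refine (mul_le_mul h1 h2 (dn_nonneg _ _ _) (by positivity)).trans (le_trans ?_ hle)
    rw [e, div_div, div_mul_div_comm, show ‖y - x‖ ^ 1 * (‖y - x‖ ^ (n - 3) * ‖y - x‖ ^ 2)
      = ‖y - x‖ ^ (n - 3) * ‖y - x‖ ^ 3 by ring]
    gcongr
    norm_num

lemma dualErr_eq_zero_mid (hV : ∀ i, ContDiff ℝ ∞ (V i))
    (hsymm : ∀ i j, pd i (V j) = pd j (V i)) (hL : 0 < L) (hy : 2 < ‖y‖) (hyL : ‖y‖ < 3 / 2 * L)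
    (k j : Fin n) : dualErr (locField L V) V (cutAnn L) k j y = 0 := by
  have h1 := cutAt_eventuallyEq_one hL hyL
  refine dualErr_eq_zero hV hsymm (fun i => ?_)
    ((cutAnn_eventuallyEq_of_two_lt hy).trans h1)
  refine (locField_eventuallyEq_of_two_lt hy i).trans ?_
  filter_upwards [h1] with z hz
  rw [hz, one_mul]

/-- Pointwise bounds for the localized test field and its dual error. -/
lemma exists_localization_bound (hn : 4 ≤ n) : ∃ C : ℝ, 0 < C ∧ ∀ (x : Euc n) (L δ : ℝ),
    4 ≤ ‖x‖ → 2 * ‖x‖ ≤ L → 0 < δ → ∀ y, y ≠ x → ∀ i k j : Fin n,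
      |pd i (testField (locField L (gradBi δ x)) k j) y|
        ≤ C / ‖x‖ ^ (n - 2) * (if ‖y‖ ≤ 2 then 1 else 0)
          + (if 3 / 2 ≤ ‖y‖ then C / ‖y - x‖ ^ (n - 1) else 0) ∧
      |dualErr (locField L (gradBi δ x)) (gradBi δ x) (cutAnn L) k j y|
        ≤ C / ‖x‖ ^ (n - 2) * (if ‖y‖ ≤ 2 then 1 else 0)
          + (if 3 / 2 * L ≤ ‖y‖ ∧ ‖y‖ ≤ 2 * L then C / L ^ n else 0) := by
  obtain ⟨A, hA, hs⟩ := exists_symb_gradBi hn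
  obtain ⟨Z, hZ1, hZ⟩ := exists_dn_cut_le n
  have hZ0 : 0 < Z := by linarith
  set C := 5 * n ^ 2 * ((1 + 16 * Z) * (2 ^ (n - 2) * A)) +
    (n + 1) * ((1 + 16 * Z) * (2 ^ (n - 2) * A)) + 5 * n ^ 2 * (216 * Z * A)
    + (n + 1) * (216 * Z * A) with hC
  have hC0 : 0 < C := by positivity
  have p1 : 0 ≤ 5 * (n : ℝ) ^ 2 * ((1 + 16 * Z) * (2 ^ (n - 2) * A)) := by positivity
  have p2 : 0 ≤ ((n : ℝ) + 1) * ((1 + 16 * Z) * (2 ^ (n - 2) * A)) := by positivity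
  have p3 : 0 ≤ 5 * (n : ℝ) ^ 2 * (216 * Z * A) := by positivity
  have p4 : 0 ≤ ((n : ℝ) + 1) * (216 * Z * A) := by positivity
  refine ⟨C, hC0, fun x L δ hx hL hδ y hyx i k j => ?_⟩
  have hsV : ∀ y, y ≠ x → ∀ i, Symb (gradBi δ x i) (A / ‖y - x‖ ^ (n - 3)) ‖y - x‖ y :=
    fun y hy i => hs δ x y i hδ hy
  have hV : ∀ i, ContDiff ℝ ∞ (gradBi δ x i) := contDiff_gradBi hδ x
  have hL0 : 0 < L := by linarith
  have hx0 : 0 < ‖x‖ := by linarith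
  have hr : 0 < ‖y - x‖ := norm_pos_iff.2 (sub_ne_zero.2 hyx)
  rcases le_or_gt ‖y‖ 2 with hy | hy
  · have a1 := abs_pd_testField_near hn hA.le hZ hV hsV hx hL hy i k j
    have a2 := abs_dualErr_near hn hA.le hZ1 hZ hV hsV hx hL hy k j
    rw [if_pos hy, mul_one]
    constructor
    · refine (a1.trans ?_).trans (le_add_of_nonneg_right (by split_ifs <;> positivity))
      rw [mul_div_assoc', mul_div_assoc']
      gcongr
      linarith
    · refine (a2.trans ?_).trans (le_add_of_nonneg_right (by split_ifs <;> positivity))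
      rw [mul_div_assoc', mul_div_assoc']
      gcongr
      linarith
  · rw [if_neg (not_le.2 hy), mul_zero, zero_add, zero_add]
    constructor
    · rw [if_pos (by linarith)]
      refine (abs_pd_testField_far hn hZ hV hsV hL0 (by linarith) hyx hy i k j).trans ?_
      rw [mul_div_assoc']
      gcongr
      linarith
    · rcases lt_or_ge ‖y‖ (3 / 2 * L) with hyL | hyL
      · rw [dualErr_eq_zero_mid hV (pd_gradBi_symm hδ x) hL0 hy hyL, abs_zero]
        split_ifs <;> positivity
      · rcases le_or_gt ‖y‖ (2 * L) with hyL2 | hyL2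
        · rw [if_pos ⟨hyL, hyL2⟩]
          refine (abs_dualErr_far hn hA.le hZ1 hZ hV hsV hx hL hyL k j).trans ?_
          rw [mul_div_assoc']
          gcongr
          linarith
        · rw [dualErr_eq_zero_of_const (c := fun _ => 0)
            (locField_eventuallyEq_of_norm_gt (by linarith) hyL2)
            (cutAnn_eventuallyEq_of_norm_gt (by linarith) hyL2), abs_zero]
          split_ifs <;> positivity

end Localization

section Limit

/-- The mass of the regularised Dirac kernel. -/
noncomputable def kerMass (n : ℕ) : ℝ := ∫ z : Euc n, (1 + ‖z‖ ^ 2) ^ (-((n : ℝ) + 4) / 2)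

lemma integrable_ker (n : ℕ) :
    Integrable fun z : Euc n => (1 + ‖z‖ ^ 2) ^ (-((n : ℝ) + 4) / 2) :=
  integrable_rpow_neg_one_add_norm_sq (by rw [finrank_euclideanSpace_fin]; linarith)

lemma kerMass_pos (n : ℕ) : 0 < kerMass n := by
  rw [kerMass, integral_pos_iff_support_of_nonneg (fun z => by positivity) (integrable_ker n),
    Function.support_eq_univ fun z => (by positivity :
      (1 + ‖z‖ ^ 2) ^ (-((n : ℝ) + 4) / 2) ≠ 0)]
  exact isOpen_univ.measure_pos _ Set.univ_nonempty

lemma integral_mul_regPow {f : Euc n → ℝ} (x : Euc n) {δ : ℝ} (hδ : 0 < δ) :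
    ∫ y, f y * (δ ^ 4 * regPow δ x (-((n : ℝ) / 2) - 2) y)
      = ∫ z, f (x + δ • z) * (1 + ‖z‖ ^ 2) ^ (-((n : ℝ) + 4) / 2) := by
  have h1 := integral_sub_right_eq_self
    (μ := (volume : Measure (Euc n)))
    (fun y => f (x + y) * (δ ^ 4 * (‖y‖ ^ 2 + δ ^ 2) ^ (-((n : ℝ) / 2) - 2))) x
  have h2 := Measure.integral_comp_smul (volume : Measure (Euc n))
    (fun y => f (x + y) * (δ ^ 4 * (‖y‖ ^ 2 + δ ^ 2) ^ (-((n : ℝ) / 2) - 2))) δ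
  have h3 : (∫ y, f y * (δ ^ 4 * regPow δ x (-((n : ℝ) / 2) - 2) y))
      = ∫ y, f (x + y) * (δ ^ 4 * (‖y‖ ^ 2 + δ ^ 2) ^ (-((n : ℝ) / 2) - 2)) := by
    rw [← h1]
    simp [regPow]
  have hδn : 0 < δ ^ n := by positivity
  rw [finrank_euclideanSpace_fin, abs_of_pos (by positivity), smul_eq_mul] at h2
  have h4 : (∫ y, f (x + y) * (δ ^ 4 * (‖y‖ ^ 2 + δ ^ 2) ^ (-((n : ℝ) / 2) - 2)))
      = δ ^ n * ∫ z, f (x + δ • z) *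
        (δ ^ 4 * (‖δ • z‖ ^ 2 + δ ^ 2) ^ (-((n : ℝ) / 2) - 2)) := by
    rw [h2, ← mul_assoc, mul_inv_cancel₀ hδn.ne', one_mul]
  rw [h3, h4, ← integral_const_mul]
  refine integral_congr_ae (Eventually.of_forall fun z => ?_)
  have h5 : ‖δ • z‖ ^ 2 + δ ^ 2 = δ ^ 2 * (1 + ‖z‖ ^ 2) := by
    rw [norm_smul, Real.norm_of_nonneg hδ.le]; ring
  have h6 : (δ ^ 2) ^ (-((n : ℝ) / 2) - 2) = (δ ^ n * δ ^ 4)⁻¹ := by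
    rw [← Real.rpow_natCast δ 2, ← Real.rpow_mul hδ.le, ← pow_add, ← Real.rpow_natCast δ (n + 4),
      ← Real.rpow_neg hδ.le]
    congr 1
    push_cast
    ring
  have h7 : -((n : ℝ) / 2) - 2 = -((n : ℝ) + 4) / 2 := by ring
  simp only
  rw [h5, Real.mul_rpow (by positivity) (by positivity), h6, h7]
  have : δ ^ n * δ ^ 4 ≠ 0 := by positivity
  field_simp

lemma tendsto_integral_mul_regPow {f : Euc n → ℝ} (hf : Continuous f) {K : ℝ}
    (hK : ∀ y, |f y| ≤ K) (x : Euc n) :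
    Tendsto (fun δ : ℝ => ∫ y, f y * (δ ^ 4 * regPow δ x (-((n : ℝ) / 2) - 2) y)) (𝓝[>] 0)
      (𝓝 (f x * kerMass n)) := by
  have h : Tendsto (fun δ : ℝ => ∫ z, f (x + δ • z) * (1 + ‖z‖ ^ 2) ^ (-((n : ℝ) + 4) / 2))
      (𝓝[>] 0) (𝓝 (f x * kerMass n)) := by
    rw [kerMass, ← integral_const_mul]
    refine tendsto_integral_filter_of_dominated_convergence
      (fun z => K * (1 + ‖z‖ ^ 2) ^ (-((n : ℝ) + 4) / 2)) ?_ ?_ ((integrable_ker n).const_mul K) ?_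
    · refine Eventually.of_forall fun δ => ?_
      exact (by fun_prop : Continuous fun z => f (x + δ • z)).aestronglyMeasurable.mul
        (integrable_ker n).aestronglyMeasurable
    · refine Eventually.of_forall fun δ => Eventually.of_forall fun z => ?_
      have : 0 ≤ (1 + ‖z‖ ^ 2) ^ (-((n : ℝ) + 4) / 2) := by positivity
      rw [norm_mul, Real.norm_of_nonneg this]
      exact mul_le_mul_of_nonneg_right (hK _) this
    · refine Eventually.of_forall fun z => Tendsto.mul_const _ ?_
      have hc : Continuous fun δ : ℝ => f (x + δ • z) := by fun_prop
      have := (hc.tendsto 0).mono_left (nhdsWithin_le_nhds (s := Set.Ioi 0))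
      simpa using this
  refine h.congr' ?_
  filter_upwards [self_mem_nhdsWithin] with δ hδ
  exact (integral_mul_regPow x hδ).symm

lemma abs_le_of_integral_lap_dvg_gradBi (hn : 4 ≤ n) {f : Euc n → ℝ} (hf : Continuous f)
    (hfc : HasCompactSupport f) {x : Euc n} {K : ℝ}
    (hK : ∀ δ, 0 < δ → |∫ y, f y * lap (dvg (gradBi δ x)) y| ≤ K) :
    |f x| ≤ K / kerMass n := by
  obtain ⟨K', hK'⟩ := hfc.exists_bound_of_continuous hf
  have ht := (tendsto_integral_mul_regPow hf hK' x).abs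
  have hn' : (4 : ℝ) ≤ n := by exact_mod_cast hn
  have hc : 1 ≤ ((n : ℝ) - 2) * n * (n + 2) := by
    nlinarith [mul_nonneg (by linarith : (0:ℝ) ≤ n - 4) (by linarith : (0:ℝ) ≤ n)]
  have hle : |f x * kerMass n| ≤ K := by
    refine le_of_tendsto ht ?_
    filter_upwards [self_mem_nhdsWithin] with δ hδ
    have h := hK δ hδ
    have e : (∫ y, f y * lap (dvg (gradBi δ x)) y) = -(((n : ℝ) - 2) * n * (n + 2)) *
        ∫ y, f y * (δ ^ 4 * regPow δ x (-((n : ℝ) / 2) - 2) y) := by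
      rw [← integral_const_mul]
      refine integral_congr_ae (Eventually.of_forall fun y => ?_)
      simp only
      rw [lap_dvg_gradBi hδ]
      ring
    rw [e, abs_mul, abs_neg, abs_of_pos (by linarith)] at h
    exact (le_mul_of_one_le_left (abs_nonneg _) hc).trans h
  rw [le_div_iff₀ (kerMass_pos n), ← abs_of_pos (kerMass_pos n), ← abs_mul]
  exact hle

end Limit

section Representation

/-- The indicator function of the closed ball of radius `ρ`. -/
noncomputable def ballInd (ρ : ℝ) (y : Euc n) : ℝ := if ‖y‖ ≤ ρ then 1 else 0

/-- The volume of the unit ball. -/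
noncomputable def unitVol (n : ℕ) : ℝ := volume.real (ball (0 : Euc n) 1)

lemma ballInd_nonneg (ρ : ℝ) (y : Euc n) : 0 ≤ ballInd ρ y := by
  unfold ballInd; split_ifs <;> norm_num

lemma ballInd_eq (ρ : ℝ) :
    (ballInd ρ : Euc n → ℝ) = (closedBall (0 : Euc n) ρ).indicator fun _ => 1 := by
  funext y
  by_cases h : ‖y‖ ≤ ρ
  · rw [ballInd, if_pos h, Set.indicator_of_mem (by simpa using h)]
  · rw [ballInd, if_neg h, Set.indicator_of_notMem (by simpa using h)]

lemma integrable_ballInd (ρ : ℝ) : Integrable (ballInd ρ : Euc n → ℝ) := by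
  rw [ballInd_eq, integrable_indicator_iff measurableSet_closedBall]
  exact integrableOn_const (isCompact_closedBall _ _).measure_lt_top.ne

lemma integral_ballInd {ρ : ℝ} (hρ : 0 ≤ ρ) :
    ∫ y : Euc n, ballInd ρ y = ρ ^ n * unitVol n := by
  rw [ballInd_eq, integral_indicator_const _ measurableSet_closedBall, smul_eq_mul, mul_one,
    unitVol, measureReal_def, Measure.addHaar_closedBall _ _ hρ, finrank_euclideanSpace_fin,
    ENNReal.toReal_mul, ENNReal.toReal_ofReal (by positivity), measureReal_def]

lemma unitVol_nonneg (n : ℕ) : 0 ≤ unitVol n := measureReal_nonneg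

/-- The terms of the weak formulation which are not concentrated at the pole. -/
noncomputable def remainder (u W V : Fin n → Euc n → ℝ) (η : Euc n → ℝ) (k : Fin n)
    (y : Euc n) : ℝ :=
  ∑ j, (u j y * dualErr W V η k j y + ∑ i, u i y * u j y * pd i (testField W k j) y)

variable {u W V : Fin n → Euc n → ℝ} {η p : Euc n → ℝ}

lemma continuous_dualErr (hW : ∀ i, ContDiff ℝ ∞ (W i)) (hV : ∀ i, ContDiff ℝ ∞ (V i))
    (hη : ContDiff ℝ ∞ η) (k j : Fin n) : Continuous (dualErr W V η k j) := by
  unfold dualErr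
  exact (((contDiff_lap (contDiff_testField hW k j)).add
    (contDiff_pd (hη.mul (contDiff_lap (hV k))) j)).sub
    (contDiff_const.mul (hη.mul (contDiff_lap (contDiff_dvg hV))))).continuous

lemma continuous_remainder (hu : ∀ i, ContDiff ℝ ∞ (u i)) (hW : ∀ i, ContDiff ℝ ∞ (W i))
    (hV : ∀ i, ContDiff ℝ ∞ (V i)) (hη : ContDiff ℝ ∞ η) (k : Fin n) :
    Continuous (remainder u W V η k) := by
  unfold remainder
  refine continuous_finsetSum _ fun j _ => ((hu j).continuous.mul
    (continuous_dualErr hW hV hη k j)).add (continuous_finsetSum _ fun i _ => ?_)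
  exact ((hu i).continuous.mul (hu j).continuous).mul
    (contDiff_pd (contDiff_testField hW k j) i).continuous

lemma hasCompactSupport_cutAnn {L : ℝ} (hL : 1 ≤ L) :
    HasCompactSupport (cutAnn L : Euc n → ℝ) :=
  hasCompactSupport_of_norm (ρ := 2 * L) fun _ hy =>
    (cutAnn_eventuallyEq_of_norm_gt hL hy).eq_of_nhds

lemma integral_eq_neg_remainder {L : ℝ} (hL : 1 ≤ L) (hu : ∀ i, ContDiff ℝ ∞ (u i))
    (hp : ContDiff ℝ ∞ p) (heq : ∀ y, 5 / 4 < ‖y‖ → Momentum u p y ∧ dvg u y = 0)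
    (hV : ∀ i, ContDiff ℝ ∞ (V i)) (k : Fin n)
    (hint : Integrable (remainder u (locField L V) V (cutAnn L) k)) :
    ∫ y, (u k y * cutAnn L y) * lap (dvg V) y
      = -∫ y, remainder u (locField L V) V (cutAnn L) k y := by
  have hW := contDiff_locField (L := L) hV
  have hη := contDiff_cutAnn (n := n) L
  have hw := weak_form (φ := testField (locField L V) k)
    (g := fun y => cutAnn L y * lap (V k) y) (ρ := 2 * L) hu hp
    (contDiff_testField hW k) (hη.mul (contDiff_lap (hV k)))
    (fun j y hy => (testField_eq_zero_of_const (c := fun _ => 0)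
      (locField_eventuallyEq_of_norm_gt hL hy) k j).eq_of_nhds)
    (fun y hy => by rw [(cutAnn_eventuallyEq_of_norm_gt hL hy).eq_of_nhds, zero_mul])
    (dvg_testField hW k) (fun y => by
      rcases lt_or_ge ‖y‖ (3 / 2) with hy | hy
      · refine Or.inl ⟨?_, fun j => ?_⟩
        · rw [(cutAnn_eventuallyEq_of_norm_lt hL hy).eq_of_nhds, zero_mul]
        · exact (testField_eq_zero_of_const
            (locField_eventuallyEq_of_norm_lt hL hy) k j).eq_of_nhds
      · exact Or.inr (heq y (by linarith)))
  have hT : Integrable fun y => (u k y * cutAnn L y) * lap (dvg V) y :=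
    (((hu k).mul hη).mul (contDiff_lap (contDiff_dvg hV))).continuous.integrable_of_hasCompactSupport
      (((hasCompactSupport_cutAnn hL).mul_left).mul_right)
  have hpt : ∀ y, (∑ j, (u j y * (lap (testField (locField L V) k j) y
      + pd j (fun y => cutAnn L y * lap (V k) y) y)
      + ∑ i, u i y * u j y * pd i (testField (locField L V) k j) y))
      = remainder u (locField L V) V (cutAnn L) k y + (u k y * cutAnn L y) * lap (dvg V) y := by
    intro y
    have : (u k y * cutAnn L y) * lap (dvg V) y
        = ∑ j, u j y * ((if j = k then 1 else 0) * (cutAnn L y * lap (dvg V) y)) := by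
      simp [mul_assoc]
    rw [this, remainder, ← Finset.sum_add_distrib]
    refine Finset.sum_congr rfl fun j _ => ?_
    rw [dualErr]
    ring
  simp only [hpt] at hw
  rw [integral_add hint hT] at hw
  linarith

lemma remainder_eq_zero {L : ℝ} (hL : 1 ≤ L) {y : Euc n} (hy : ‖y‖ < 3 / 2) (k : Fin n) :
    remainder u (locField L V) V (cutAnn L) k y = 0 := by
  refine Finset.sum_eq_zero fun j _ => ?_
  rw [dualErr_eq_zero_of_const (locField_eventuallyEq_of_norm_lt hL hy)
    (cutAnn_eventuallyEq_of_norm_lt hL hy), mul_zero, zero_add]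
  refine Finset.sum_eq_zero fun i _ => ?_
  rw [pd_testField_eq_zero_of_const (locField_eventuallyEq_of_norm_lt hL hy), mul_zero]

/-- The majorant of the remainder terms. -/
noncomputable def majorant (n : ℕ) (C ε A B L : ℝ) (x y : Euc n) : ℝ :=
  (n * (C / ‖x‖ ^ (n - 2)) + n ^ 2 * (C / ‖x‖ ^ (n - 2))) * ballInd 2 y
    + n * (C / L ^ (n + 1)) * ballInd (2 * L) y
    + n ^ 2 * (C * ε * A) * potK n (n - 1) x y + n ^ 2 * (C * ε * B) * potK n 2 x y

lemma abs_remainder_le_majorant (hn : 4 ≤ n) {C ε A B L : ℝ} (hC : 0 < C) (hε0 : 0 ≤ ε)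
    (hε : ε ≤ 1) (hA : 0 ≤ A) (hB : 0 ≤ B) (hL : 1 ≤ L) {x y : Euc n} {k : Fin n}
    (h1 : ∀ i j, |pd i (testField (locField L V) k j) y|
        ≤ C / ‖x‖ ^ (n - 2) * (if ‖y‖ ≤ 2 then 1 else 0)
          + (if 3 / 2 ≤ ‖y‖ then C / ‖y - x‖ ^ (n - 1) else 0))
    (h2 : ∀ j, |dualErr (locField L V) V (cutAnn L) k j y|
        ≤ C / ‖x‖ ^ (n - 2) * (if ‖y‖ ≤ 2 then 1 else 0)
          + (if 3 / 2 * L ≤ ‖y‖ ∧ ‖y‖ ≤ 2 * L then C / L ^ n else 0))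
    (huε : 3 / 2 ≤ ‖y‖ → ∀ j, |u j y| ≤ ε / ‖y‖)
    (huAB : 3 / 2 ≤ ‖y‖ → ∀ j, |u j y| ≤ A / ‖y‖ ^ (n - 2) + B / ‖y‖) :
    |remainder u (locField L V) V (cutAnn L) k y| ≤ majorant n C ε A B L x y := by
  have hpos : 0 ≤ majorant n C ε A B L x y := by
    have := ballInd_nonneg 2 y
    have := ballInd_nonneg (2 * L) y
    have := potK_nonneg (n - 1) x y
    have := potK_nonneg 2 x y
    unfold majorant
    positivity
  rcases lt_or_ge ‖y‖ (3 / 2) with hy | hy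
  · rw [remainder_eq_zero hL hy, abs_zero]; exact hpos
  have huε := huε hy
  have huAB := huAB hy
  have hy0 : 0 < ‖y‖ := by linarith
  have hL0 : 0 < L := by linarith
  set a := C / ‖x‖ ^ (n - 2) with ha
  have ha0 : 0 ≤ a := by positivity
  have hu1 : ∀ j, |u j y| ≤ 1 := fun j => (huε j).trans (by rw [div_le_one hy0]; linarith)
  have e1 : ∀ j, |u j y * dualErr (locField L V) V (cutAnn L) k j y|
      ≤ a * ballInd 2 y + C / L ^ (n + 1) * ballInd (2 * L) y := by
    intro j
    rw [abs_mul]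
    refine (mul_le_mul_of_nonneg_left (h2 j) (abs_nonneg _)).trans ?_
    rw [mul_add]
    refine add_le_add (mul_le_of_le_one_left ?_ (hu1 j)) ?_
    · exact mul_nonneg ha0 (ballInd_nonneg 2 y)
    · by_cases h : 3 / 2 * L ≤ ‖y‖ ∧ ‖y‖ ≤ 2 * L
      · rw [if_pos h, ballInd, if_pos h.2, mul_one]
        have : |u j y| ≤ 1 / L := (huε j).trans (by gcongr; linarith)
        calc |u j y| * (C / L ^ n) ≤ 1 / L * (C / L ^ n) := by gcongr
          _ = C / L ^ (n + 1) := by rw [div_mul_div_comm, one_mul, pow_succ']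
      · rw [if_neg h, mul_zero]
        exact mul_nonneg (by positivity) (ballInd_nonneg _ y)
  have e2 : ∀ i j, |u i y * u j y * pd i (testField (locField L V) k j) y|
      ≤ a * ballInd 2 y
        + (C * ε * A * potK n (n - 1) x y + C * ε * B * potK n 2 x y) := by
    intro i j
    rw [abs_mul, abs_mul]
    refine (mul_le_mul_of_nonneg_left (h1 i j) (by positivity)).trans ?_
    rw [mul_add, if_pos hy]
    refine add_le_add (mul_le_of_le_one_left ?_ ?_) ?_
    · exact mul_nonneg ha0 (ballInd_nonneg 2 y)
    · exact mul_le_one₀ (hu1 i) (abs_nonneg _) (hu1 j)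
    · calc |u i y| * |u j y| * (C / ‖y - x‖ ^ (n - 1))
          ≤ ε / ‖y‖ * (A / ‖y‖ ^ (n - 2) + B / ‖y‖) * (C / ‖y - x‖ ^ (n - 1)) := by
            gcongr
            · exact huε i
            · exact huAB j
        _ = _ := by
            unfold potK
            rw [show n - 1 = (n - 2) + 1 by omega, pow_succ ‖y‖ (n - 2)]
            field_simp
  have e3 : |remainder u (locField L V) V (cutAnn L) k y| ≤ ∑ _j : Fin n,
      ((a * ballInd 2 y + C / L ^ (n + 1) * ballInd (2 * L) y) + ∑ _i : Fin n,
        (a * ballInd 2 y + (C * ε * A * potK n (n - 1) x y + C * ε * B * potK n 2 x y))) := by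
    refine (Finset.abs_sum_le_sum_abs _ _).trans (Finset.sum_le_sum fun j _ => ?_)
    refine (abs_add_le _ _).trans (add_le_add (e1 j) ?_)
    exact (Finset.abs_sum_le_sum_abs _ _).trans (Finset.sum_le_sum fun i _ => e2 i j)
  refine e3.trans (le_of_eq ?_)
  simp only [Finset.sum_const, Finset.card_univ, Fintype.card_fin, nsmul_eq_mul, majorant]
  ring

lemma exists_majorant_bound (hn : 4 ≤ n) : ∃ P : ℝ, 0 < P ∧ ∀ (C ε A B L : ℝ) (x : Euc n),
    0 < C → 0 ≤ ε → 0 ≤ A → 0 ≤ B → 1 ≤ L → x ≠ 0 →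
    Integrable (majorant n C ε A B L x) ∧
    ∫ y, majorant n C ε A B L x y
      ≤ C * P * (1 / ‖x‖ ^ (n - 2) + 1 / L + ε * (A / ‖x‖ ^ (n - 2) + B / ‖x‖)) := by
  obtain ⟨D, hD, h1⟩ := exists_potK_bound (n := n) (b := n - 1) (by omega) (by omega) le_rfl
  obtain ⟨E, hE, h2⟩ := exists_potK_bound (n := n) (b := 2) (by omega) (by omega) (by omega)
  have hv := unitVol_nonneg n
  refine ⟨(n + n ^ 2) * 2 ^ n * unitVol n + n ^ 2 * (D + E), by positivity,
    fun C ε A B L x hC hε hA hB hL hx => ?_⟩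
  obtain ⟨i1, b1⟩ := h1 x hx
  obtain ⟨i2, b2⟩ := h2 x hx
  have hx0 : 0 < ‖x‖ := norm_pos_iff.2 hx
  have hL0 : 0 < L := by linarith
  have j1 := (integrable_ballInd (n := n) 2).const_mul
    (n * (C / ‖x‖ ^ (n - 2)) + n ^ 2 * (C / ‖x‖ ^ (n - 2)))
  have j2 := (integrable_ballInd (n := n) (2 * L)).const_mul (n * (C / L ^ (n + 1)))
  have j3 := i1.const_mul (n ^ 2 * (C * ε * A))
  have j12 : Integrable fun y => (n * (C / ‖x‖ ^ (n - 2)) + n ^ 2 * (C / ‖x‖ ^ (n - 2))) *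
      ballInd 2 y + n * (C / L ^ (n + 1)) * ballInd (2 * L) y := j1.add j2
  have j123 : Integrable fun y => (n * (C / ‖x‖ ^ (n - 2)) + n ^ 2 * (C / ‖x‖ ^ (n - 2))) *
      ballInd 2 y + n * (C / L ^ (n + 1)) * ballInd (2 * L) y
      + n ^ 2 * (C * ε * A) * potK n (n - 1) x y := j12.add j3
  have j4 := i2.const_mul (n ^ 2 * (C * ε * B))
  refine ⟨j123.add j4, ?_⟩
  unfold majorant
  rw [integral_add j123 j4, integral_add j12 j3, integral_add j1 j2]
  simp only [integral_const_mul]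
  rw [integral_ballInd (by norm_num), integral_ballInd (by linarith)]
  rw [show n - 1 - 1 = n - 2 by omega] at b1
  rw [show 2 - 1 = 1 by rfl, pow_one] at b2
  have c1 : (n : ℝ) ^ 2 * (C * ε * A) * ∫ y, potK n (n - 1) x y
      ≤ n ^ 2 * (C * ε * A) * (D / ‖x‖ ^ (n - 2)) := by gcongr
  have c2 : (n : ℝ) ^ 2 * (C * ε * B) * ∫ y, potK n 2 x y
      ≤ n ^ 2 * (C * ε * B) * (E / ‖x‖) := by gcongr
  have c3 : (n : ℝ) * (C / L ^ (n + 1)) * ((2 * L) ^ n * unitVol n)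
      = n * C * 2 ^ n * unitVol n * (1 / L) := by
    rw [mul_pow, pow_succ]; field_simp
  rw [c3]
  refine (add_le_add (add_le_add le_rfl c1) c2).trans ?_
  have q1 : 0 ≤ (n : ℝ) ^ 2 * 2 ^ n * unitVol n := by positivity
  have q2 : 0 ≤ (n : ℝ) * 2 ^ n * unitVol n := by positivity
  have r1 : 0 ≤ 1 / ‖x‖ ^ (n - 2) := by positivity
  have r2 : 0 ≤ 1 / L := by positivity
  have r3 : 0 ≤ ε * (A / ‖x‖ ^ (n - 2)) := by positivity
  have r4 : 0 ≤ ε * (B / ‖x‖) := by positivity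
  have hD' : 0 ≤ (n : ℝ) ^ 2 * D := by positivity
  have hE' : 0 ≤ (n : ℝ) ^ 2 * E := by positivity
  have : C * ((n + n ^ 2) * 2 ^ n * unitVol n + n ^ 2 * (D + E)) *
      (1 / ‖x‖ ^ (n - 2) + 1 / L + ε * (A / ‖x‖ ^ (n - 2) + B / ‖x‖)) -
      ((n * (C / ‖x‖ ^ (n - 2)) + n ^ 2 * (C / ‖x‖ ^ (n - 2))) * (2 ^ n * unitVol n)
        + n * C * 2 ^ n * unitVol n * (1 / L) + n ^ 2 * (C * ε * A) * (D / ‖x‖ ^ (n - 2))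
        + n ^ 2 * (C * ε * B) * (E / ‖x‖))
      = C * ((n ^ 2 * D + n ^ 2 * E) * (1 / ‖x‖ ^ (n - 2) + 1 / L)
        + n ^ 2 * 2 ^ n * unitVol n * (1 / L)
        + (n * 2 ^ n * unitVol n + n ^ 2 * 2 ^ n * unitVol n)
          * (ε * (A / ‖x‖ ^ (n - 2)) + ε * (B / ‖x‖))
        + n ^ 2 * E * (ε * (A / ‖x‖ ^ (n - 2))) + n ^ 2 * D * (ε * (B / ‖x‖))) := by
    ring
  rw [← sub_nonneg, this]
  positivity

/-- The potential estimate for the components of a small solution. -/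
lemma exists_component_bound (hn : 4 ≤ n) : ∃ K : ℝ, 0 < K ∧ ∀ (u : Fin n → Euc n → ℝ)
    (p : Euc n → ℝ) (ε A B : ℝ), (∀ i, ContDiff ℝ ∞ (u i)) → ContDiff ℝ ∞ p →
    (∀ y, 5 / 4 < ‖y‖ → Momentum u p y ∧ dvg u y = 0) → 0 ≤ ε → ε ≤ 1 → 0 ≤ A → 0 ≤ B →
    (∀ y, 3 / 2 ≤ ‖y‖ → ∀ j, |u j y| ≤ ε / ‖y‖) →
    (∀ y, 3 / 2 ≤ ‖y‖ → ∀ j, |u j y| ≤ A / ‖y‖ ^ (n - 2) + B / ‖y‖) →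
    ∀ x, 4 ≤ ‖x‖ → ∀ k,
      |u k x| ≤ K * (1 / ‖x‖ ^ (n - 2) + ε * (A / ‖x‖ ^ (n - 2) + B / ‖x‖)) := by
  obtain ⟨C, hC, h⟩ := exists_localization_bound hn
  obtain ⟨P, hP, hmaj⟩ := exists_majorant_bound hn
  have hM := kerMass_pos n
  refine ⟨C * P / kerMass n, by positivity,
    fun u p ε A B hu hp heq hε0 hε hA hB huε huAB x hx k => ?_⟩
  have hx0 : x ≠ 0 := by rintro rfl; simp at hx; linarith
  set S := 1 / ‖x‖ ^ (n - 2) + ε * (A / ‖x‖ ^ (n - 2) + B / ‖x‖) with hS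
  have hmain : ∀ L, 2 * ‖x‖ ≤ L → |u k x| ≤ C * P * (S + 1 / L) / kerMass n := by
    intro L hL
    have hL1 : 1 ≤ L := by linarith
    have hηx : cutAnn L x = 1 := by
      rw [cutAnn, cut_eq_zero (by linarith), cutAt_eq_one (by linarith) (by linarith), sub_zero]
    have hb := abs_le_of_integral_lap_dvg_gradBi hn (f := fun y => u k y * cutAnn L y) (x := x)
      (K := C * P * (S + 1 / L)) ((hu k).mul (contDiff_cutAnn L)).continuous
      ((hasCompactSupport_cutAnn hL1).mul_left) (fun δ hδ => ?_)
    · simpa only [hηx, mul_one] using hb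
    · have hV := contDiff_gradBi hδ x
      obtain ⟨hmi, hmb⟩ := hmaj C ε A B L x hC hε0 hA hB hL1 hx0
      have hle : ∀ᵐ y, ‖remainder u (locField L (gradBi δ x)) (gradBi δ x) (cutAnn L) k y‖
          ≤ majorant n C ε A B L x y := by
        have : Nontrivial (Euc n) := ⟨x, 0, hx0⟩
        filter_upwards [Measure.ae_ne volume x] with y hyx
        exact abs_remainder_le_majorant hn hC hε0 hε hA hB hL1
          (fun i j => (h x L δ hx hL hδ y hyx i k j).1)
          (fun j => (h x L δ hx hL hδ y hyx k k j).2) (huε y) (huAB y)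
      have hint := hmi.mono' (continuous_remainder hu (contDiff_locField hV) hV
        (contDiff_cutAnn L) k).aestronglyMeasurable hle
      rw [integral_eq_neg_remainder hL1 hu hp heq hV k hint, abs_neg]
      refine (norm_integral_le_of_norm_le hmi hle).trans (hmb.trans (le_of_eq ?_))
      rw [hS]; ring
  have ht : Tendsto (fun L : ℝ => C * P * (S + 1 / L) / kerMass n) atTop
      (𝓝 (C * P * (S + 0) / kerMass n)) := by
    refine ((tendsto_const_nhds.add ?_).const_mul _).div_const _
    exact tendsto_inv_atTop_zero.congr fun L => (one_div L).symm
  refine (ge_of_tendsto ht ?_).trans (le_of_eq (by ring))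
  filter_upwards [eventually_ge_atTop (2 * ‖x‖)] with L hL using hmain L hL

end Representation

section Decay

lemma exists_global_extension {f : Euc n → ℝ} (hf : ContDiffOn ℝ ∞ f {y | 1 < ‖y‖}) :
    ∃ g, ContDiff ℝ ∞ g ∧ ∀ y, 5 / 4 < ‖y‖ → g y = f y := by
  let b : ContDiffBump (0 : Euc n) := ⟨9 / 8, 5 / 4, by norm_num, by norm_num⟩
  refine ⟨fun y => (1 - b y) * f y, contDiff_iff_contDiffAt.2 fun y => ?_, fun y hy => ?_⟩
  · rcases lt_or_ge 1 ‖y‖ with hy | hy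
    · exact (contDiffAt_const.sub b.contDiff.contDiffAt).mul
        (hf.contDiffAt ((isOpen_norm_gt 1).mem_nhds hy))
    · have h : (fun y => (1 - b y) * f y) =ᶠ[𝓝 y] fun _ => 0 := by
        filter_upwards [(isOpen_norm_lt (9 / 8)).mem_nhds
          (show ‖y‖ < 9 / 8 by linarith)] with z hz
        have hz : ‖z‖ < 9 / 8 := hz
        rw [b.one_of_mem_closedBall (by simpa [b] using hz.le)]
        ring
      exact contDiffAt_const.congr_of_eventuallyEq h
  · have : b y = 0 := b.zero_of_le_dist (by simpa [b] using hy.le)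
    simp only [this]
    ring

lemma Momentum.congr {u v : Fin n → Euc n → ℝ} {p q : Euc n → ℝ} {y : Euc n}
    (huv : ∀ j, v j =ᶠ[𝓝 y] u j) (hpq : q =ᶠ[𝓝 y] p) (h : Momentum u p y) : Momentum v q y := by
  intro j
  rw [(lap_congr (huv j)).eq_of_nhds, (pd_congr hpq).eq_of_nhds, ← h j]
  congr 3
  funext i
  rw [(huv i).eq_of_nhds, (pd_congr (huv j)).eq_of_nhds]

lemma norm_le_sum_abs (v : Euc n) : ‖v‖ ≤ ∑ j, |v j| := by
  rw [EuclideanSpace.norm_eq]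
  refine Real.sqrt_le_iff.2 ⟨Finset.sum_nonneg fun j _ => abs_nonneg _, ?_⟩
  exact Finset.sum_sq_le_sq_sum_of_nonneg fun j _ => abs_nonneg (v j)

lemma abs_apply_le_norm (v : Euc n) (j : Fin n) : |v j| ≤ ‖v‖ := PiLp.norm_apply_le v j

/-- The decay estimate in the exterior of the unit ball. -/
lemma exists_unit_decay (hn : 4 ≤ n) : ∃ ε C : ℝ, 0 < ε ∧ ε < 1 ∧ 0 < C ∧
    ∀ (u : Euc n → Euc n) (p : Euc n → ℝ), ContDiffOn ℝ ∞ u {y | 1 < ‖y‖} →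
      ContDiffOn ℝ ∞ p {y | 1 < ‖y‖} →
      (∀ y, 1 < ‖y‖ → Momentum (fun j z => u z j) p y) →
      (∀ y, 1 < ‖y‖ → dvg (fun j z => u z j) y = 0) →
      (∀ y, 1 ≤ ‖y‖ → ‖u y‖ ≤ ε / ‖y‖) → ∀ y, 1 ≤ ‖y‖ → ‖u y‖ ≤ C / ‖y‖ ^ (n - 2) := by
  obtain ⟨K, hK, h⟩ := exists_component_bound hn
  have hn0 : (0 : ℝ) < n := by exact_mod_cast (by omega : 0 < n)
  have hnK : 0 < n * K := by positivity
  set A : ℝ := 2 * (n * K) + 4 ^ (n - 3) with hA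
  have hA0 : 0 < A := by positivity
  refine ⟨min (1 / 2) (1 / (2 * (n * K))), A, by positivity,
    (min_le_left _ _).trans_lt (by norm_num), hA0, ?_⟩
  intro u p hu hp hmom hdiv hsmall
  set ε := min (1 / 2) (1 / (2 * (n * K))) with hε
  have hε0 : 0 < ε := by positivity
  have hε1 : ε ≤ 1 := (min_le_left _ _).trans (by norm_num)
  have hεK : n * K * ε ≤ 1 / 2 := by
    calc n * K * ε ≤ n * K * (1 / (2 * (n * K))) := by gcongr; exact min_le_right _ _
      _ = 1 / 2 := by field_simp
  have huj : ∀ j, ContDiffOn ℝ ∞ (fun z => u z j) {y | 1 < ‖y‖} :=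
    fun j => (contDiffOn_euclidean.1 hu) j
  choose v hv hvu using fun j => exists_global_extension (huj j)
  obtain ⟨q, hq, hqp⟩ := exists_global_extension hp
  have hev : ∀ y : Euc n, 5 / 4 < ‖y‖ → ∀ j, v j =ᶠ[𝓝 y] fun z => u z j := by
    intro y hy j
    filter_upwards [(isOpen_norm_gt (5 / 4)).mem_nhds hy] with z hz using hvu j z hz
  have heq : ∀ y, 5 / 4 < ‖y‖ → Momentum v q y ∧ dvg v y = 0 := by
    intro y hy
    refine ⟨(hmom y (by linarith)).congr (hev y hy) ?_, ?_⟩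
    · filter_upwards [(isOpen_norm_gt (5 / 4)).mem_nhds hy] with z hz using hqp z hz
    · rw [(dvg_congr (hev y hy)).eq_of_nhds, hdiv y (by linarith)]
  have hvle : ∀ y, 3 / 2 ≤ ‖y‖ → ∀ j, |v j y| ≤ ‖u y‖ := by
    intro y hy j
    rw [hvu j y (by linarith)]
    exact abs_apply_le_norm _ _
  have hiter : ∀ m : ℕ, ∀ y, 1 ≤ ‖y‖ → ‖u y‖ ≤ A / ‖y‖ ^ (n - 2) + (1 / 2) ^ m / ‖y‖ := by
    intro m
    induction m with
    | zero =>
      intro y hy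
      rw [pow_zero]
      refine (hsmall y hy).trans ?_
      have : 0 ≤ A / ‖y‖ ^ (n - 2) := by positivity
      have : ε / ‖y‖ ≤ 1 / ‖y‖ := by gcongr
      linarith
    | succ m ih =>
      intro y hy
      have hy0 : 0 < ‖y‖ := by linarith
      rcases le_or_gt 4 ‖y‖ with hy4 | hy4
      · have hc := h v q ε A ((1 / 2) ^ m) hv hq heq hε0.le hε1 hA0.le (by positivity)
          (fun z hz j => (hvle z hz j).trans (hsmall z (by linarith)))
          (fun z hz j => (hvle z hz j).trans (ih z (by linarith))) y hy4
        set S := 1 / ‖y‖ ^ (n - 2) + ε * (A / ‖y‖ ^ (n - 2) + (1 / 2) ^ m / ‖y‖) with hS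
        have hsum : ‖u y‖ ≤ n * (K * S) := by
          refine (norm_le_sum_abs _).trans ((Finset.sum_le_sum (g := fun _ => K * S)
            fun j _ => ?_).trans_eq (by simp))
          rw [← hvu j y (by linarith)]
          exact hc j
        have e : n * (K * S) = (n * K) / ‖y‖ ^ (n - 2)
            + (n * K * ε) * (A / ‖y‖ ^ (n - 2) + (1 / 2) ^ m / ‖y‖) := by
          rw [hS]; ring
        have hT : (n * K * ε) * (A / ‖y‖ ^ (n - 2) + (1 / 2) ^ m / ‖y‖)
            ≤ 1 / 2 * (A / ‖y‖ ^ (n - 2) + (1 / 2) ^ m / ‖y‖) := by gcongr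
        have hKA : (n * K) / ‖y‖ ^ (n - 2) ≤ (A / 2) / ‖y‖ ^ (n - 2) := by
          gcongr
          have : (0 : ℝ) ≤ 4 ^ (n - 3) := by positivity
          linarith
        have e2 : (A / 2) / ‖y‖ ^ (n - 2) + 1 / 2 * (A / ‖y‖ ^ (n - 2) + (1 / 2) ^ m / ‖y‖)
            = A / ‖y‖ ^ (n - 2) + (1 / 2) ^ (m + 1) / ‖y‖ := by
          rw [pow_succ]; ring
        linarith
      · have h1 : ε / ‖y‖ ≤ A / ‖y‖ ^ (n - 2) := by
          rw [div_le_div_iff₀ hy0 (by positivity), show n - 2 = (n - 3) + 1 by omega, pow_succ,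
            ← mul_assoc]
          refine mul_le_mul_of_nonneg_right ?_ hy0.le
          calc ε * ‖y‖ ^ (n - 3) ≤ 1 * 4 ^ (n - 3) := by gcongr
            _ ≤ A := by linarith
        have : 0 ≤ (1 / 2 : ℝ) ^ (m + 1) / ‖y‖ := by positivity
        linarith [hsmall y hy]
  intro y hy
  have ht : Tendsto (fun m : ℕ => A / ‖y‖ ^ (n - 2) + (1 / 2 : ℝ) ^ m / ‖y‖) atTop
      (𝓝 (A / ‖y‖ ^ (n - 2) + 0 / ‖y‖)) :=
    tendsto_const_nhds.add
      ((tendsto_pow_atTop_nhds_zero_of_lt_one (by norm_num) (by norm_num)).div_const _)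
  rw [zero_div, add_zero] at ht
  exact ge_of_tendsto' ht fun m => hiter m y hy

lemma pd_rescale (c R : ℝ) (f : Euc n → ℝ) (i : Fin n) :
    pd i (fun y => c * f (R • y)) = fun y => c * R * pd i f (R • y) := by
  funext y
  have h1 : fderiv ℝ (fun y => c * f (R • y)) y = c • fderiv ℝ (fun y => f (R • y)) y :=
    congrFun (fderiv_const_smul_field c) y
  simp only [pd]
  rw [h1, fderiv_comp_smul]
  simp [mul_assoc]

lemma lap_rescale (c R : ℝ) (f : Euc n → ℝ) (y : Euc n) :
    lap (fun y => c * f (R • y)) y = c * R ^ 2 * lap f (R • y) := by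
  simp only [lap, pd_rescale, Finset.mul_sum]
  exact Finset.sum_congr rfl fun i _ => by ring

lemma Momentum.rescale {u : Fin n → Euc n → ℝ} {p : Euc n → ℝ} {R : ℝ} {y : Euc n}
    (h : Momentum u p (R • y)) :
    Momentum (fun j z => R * u j (R • z)) (fun z => R ^ 2 * p (R • z)) y := by
  intro j
  have hj := h j
  simp only [lap_rescale, pd_rescale]
  have e : ∑ i, R * u i (R • y) * (R * R * pd i (u j) (R • y))
      = R ^ 3 * ∑ i, u i (R • y) * pd i (u j) (R • y) := by
    rw [Finset.mul_sum]
    exact Finset.sum_congr rfl fun i _ => by ring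
  rw [e]
  linear_combination R ^ 3 * hj

lemma dvg_rescale (R : ℝ) (u : Fin n → Euc n → ℝ) (y : Euc n) :
    dvg (fun j z => R * u j (R • z)) y = R ^ 2 * dvg u (R • y) := by
  simp only [dvg, pd_rescale, Finset.mul_sum]
  exact Finset.sum_congr rfl fun i _ => by ring

/-- The decay estimate in the exterior of the ball of radius `R`. -/
lemma exists_decay (hn : 4 ≤ n) : ∃ ε C : ℝ, 0 < ε ∧ ε < 1 ∧ 0 < C ∧ ∀ R : ℝ, 0 < R →
    ∀ (u : Euc n → Euc n) (p : Euc n → ℝ), ContDiffOn ℝ ∞ u {y | R < ‖y‖} →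
      ContDiffOn ℝ ∞ p {y | R < ‖y‖} →
      (∀ y, R < ‖y‖ → Momentum (fun j z => u z j) p y) →
      (∀ y, R < ‖y‖ → dvg (fun j z => u z j) y = 0) →
      (∀ y, R ≤ ‖y‖ → ‖u y‖ ≤ ε / ‖y‖) →
      ∀ y, R ≤ ‖y‖ → ‖u y‖ ≤ C * R ^ (n - 3) / ‖y‖ ^ (n - 2) := by
  obtain ⟨ε, C, hε, hε1, hC, h⟩ := exists_unit_decay hn
  refine ⟨ε, C, hε, hε1, hC, fun R hR u p hu hp hmom hdiv hsmall y hy => ?_⟩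
  have hnorm : ∀ z : Euc n, ‖R • z‖ = R * ‖z‖ := fun z => by
    rw [norm_smul, Real.norm_of_nonneg hR.le]
  have hlt : ∀ z : Euc n, 1 < ‖z‖ → R < ‖R • z‖ := fun z hz => by
    rw [hnorm]; exact lt_mul_of_one_lt_right hR hz
  have hle : ∀ z : Euc n, 1 ≤ ‖z‖ → R ≤ ‖R • z‖ := fun z hz => by
    rw [hnorm]; exact le_mul_of_one_le_right hR.le hz
  have hy0 : 0 < ‖y‖ := hR.trans_le hy
  have hRy : ‖R⁻¹ • y‖ = ‖y‖ / R := norm_inv_smul hR y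
  have hs : ContDiffOn ℝ ∞ (fun z : Euc n => R • z) {z | 1 < ‖z‖} :=
    (contDiff_const_smul R).contDiffOn
  have key := h (fun z => R • u (R • z)) (fun z => R ^ 2 * p (R • z))
    ((hu.comp hs hlt).const_smul R) (contDiffOn_const.mul (hp.comp hs hlt))
    (fun z hz => (hmom _ (hlt z hz)).rescale)
    (fun z hz => by
      have := dvg_rescale R (fun j z => u z j) z
      rw [hdiv _ (hlt z hz), mul_zero] at this
      exact this)
    (fun z hz => by
      have hz0 : 0 < ‖z‖ := by linarith
      rw [hnorm]
      refine (mul_le_mul_of_nonneg_left (hsmall _ (hle z hz)) hR.le).trans_eq ?_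
      rw [hnorm]
      field_simp)
    (R⁻¹ • y) (by rw [hRy, one_le_div hR]; exact hy)
  simp only [smul_inv_smul₀ hR.ne', hRy, norm_smul, Real.norm_of_nonneg hR.le, div_pow] at key
  rw [le_div_iff₀ (by positivity)]
  rw [div_div_eq_mul_div, le_div_iff₀ (by positivity), show n - 2 = (n - 3) + 1 by omega,
    pow_succ R] at key
  rw [show n - 2 = (n - 3) + 1 by omega]
  refine le_of_mul_le_mul_left ?_ hR
  linarith

end Decay

end SteadyNS

/-- **Small-solution decay estimate in exterior domains, uniform in `R`, n ≥ 4.**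
There exist `ε ∈ (0,1)` and `C > 0`, depending only on `n`, such that every smooth
solution `(u, p)` of the steady Navier-Stokes equations on `ℝⁿ \ B_R` with
`|u(x)| ≤ ε/|x|` for `|x| ≥ R` satisfies `|u(x)| ≤ C R^{n-3}/|x|^{n-2}` for `|x| ≥ R`. -/
theorem steady_NS_exterior_epsilon_decay {n : ℕ} (hn : 4 ≤ n) :
    ∃ ε C : ℝ, 0 < ε ∧ ε < 1 ∧ 0 < C ∧
      ∀ R : ℝ, 0 < R →
      ∀ (u : EuclideanSpace ℝ (Fin n) → EuclideanSpace ℝ (Fin n))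
        (p : EuclideanSpace ℝ (Fin n) → ℝ),
        ContDiffOn ℝ (⊤ : ℕ∞) u {x : EuclideanSpace ℝ (Fin n) | R < ‖x‖} →
        ContDiffOn ℝ (⊤ : ℕ∞) p {x : EuclideanSpace ℝ (Fin n) | R < ‖x‖} →
        (∀ x : EuclideanSpace ℝ (Fin n), R < ‖x‖ → ∀ j : Fin n,
          -(∑ i : Fin n, fderiv ℝ (fun y => fderiv ℝ (fun z => u z j) y
                (EuclideanSpace.single i 1)) x (EuclideanSpace.single i 1)) +
            (∑ i : Fin n, u x i * fderiv ℝ (fun z => u z j) x (EuclideanSpace.single i 1)) +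
            fderiv ℝ p x (EuclideanSpace.single j 1) = 0) →
        (∀ x : EuclideanSpace ℝ (Fin n), R < ‖x‖ →
          ∑ i : Fin n, fderiv ℝ (fun z => u z i) x (EuclideanSpace.single i 1) = 0) →
        (∀ x : EuclideanSpace ℝ (Fin n), R ≤ ‖x‖ → ‖u x‖ ≤ ε / ‖x‖) →
        ∀ x : EuclideanSpace ℝ (Fin n), R ≤ ‖x‖ →
          ‖u x‖ ≤ C * R ^ (n - 3) / ‖x‖ ^ (n - 2) := by
  exact SteadyNS.exists_decay hn
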